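/- arXiv:2309.12748 — 5 statements merged into one kernel-verified Lean document; each statement's English description precedes it below -/
import Mathlib

section
/- For every positive integer n, every sequence of legal moves of the reversed Zeckendorf game starting at the Zeckendorf decomposition z(n) is finite, and every complete play of the reversed Zeckendorf game on n ends at the state with h_1 = n and h_i = 0 for all i ≥ 2. -/
/-- The Fibonacci numbers indexed so that `zfib 1 = 1`, `zfib 2 = 2`,
and `zfib (i+1) = zfib i + zfib (i-1)`. -/
def zfib (i : ℕ) : ℕ := Nat.fib (i + 1)

/-- A game state: a finitely supported function recording the height of each bin.
Bin indices start at `1`; index `0` is unused. -/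
abbrev ZState := ℕ →₀ ℕ

/-- The legal moves of the reversed Zeckendorf game. -/
inductive ZMove : ZState → ZState → Prop
  | split (h : ZState) (i : ℕ) (hi : 2 ≤ i) (hpos : 0 < h (i + 1)) :
      ZMove h (h - Finsupp.single (i + 1) 1 + Finsupp.single i 1 + Finsupp.single (i - 1) 1)
  | splitTwo (h : ZState) (hpos : 0 < h 2) :
      ZMove h (h - Finsupp.single 2 1 + Finsupp.single 1 2)
  | combine (h : ZState) (i : ℕ) (hi : 2 < i) (h1 : 0 < h (i + 1)) (h2 : 0 < h (i - 2)) :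
      ZMove h (h - Finsupp.single (i + 1) 1 - Finsupp.single (i - 2) 1 + Finsupp.single i 2)
  | combineTwo (h : ZState) (h1 : 0 < h 3) (h2 : 0 < h 1) :
      ZMove h (h - Finsupp.single 3 1 - Finsupp.single 1 1 + Finsupp.single 2 2)

/-- `z` is the Zeckendorf decomposition of `n`: heights are `0` or `1`,
no two adjacent bins are occupied, bin `0` is unused, and the total value is `n`. -/
def IsZeckendorf (n : ℕ) (z : ZState) : Prop :=
  z 0 = 0 ∧ (∀ i, z i ≤ 1) ∧ (∀ i, ¬(0 < z i ∧ 0 < z (i + 1))) ∧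
    (z.sum fun i v => v * zfib i) = n

/-- `l` is a complete play starting at `start`: it begins at `start`, consecutive
states are related by legal moves, and the final state admits no legal move.
Its length (number of moves) is `l.length - 1`. -/
def IsCompletePlay (start : ZState) (l : List ZState) : Prop :=
  l.head? = some start ∧ l.Chain' ZMove ∧ ∀ x ∈ l.getLast?, ∀ h', ¬ ZMove x h'

/-- Total weight of a state. -/
noncomputable def zW (w : ℕ → ℕ) (h : ZState) : ℕ := h.sum fun i v => v * w i

theorem zW_add (w : ℕ → ℕ) (a b : ZState) : zW w (a + b) = zW w a + zW w b := by
  unfold zW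
  exact Finsupp.sum_add_index' (by simp) (by intros; ring)

theorem zW_single (w : ℕ → ℕ) (i k : ℕ) : zW w (Finsupp.single i k) = k * w i := by
  unfold zW
  exact Finsupp.sum_single_index (by simp)

theorem zW_sub (w : ℕ → ℕ) (h : ZState) (i : ℕ) (hi : 0 < h i) :
    zW w (h - Finsupp.single i 1) + w i = zW w h := by
  have hle : Finsupp.single i 1 ≤ h := by
    rw [Finsupp.single_le_iff]; exact hi
  have h2 := zW_add w (h - Finsupp.single i 1) (Finsupp.single i 1)
  rw [tsub_add_cancel_of_le hle, zW_single] at h2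
  omega

theorem zmove_weight (w : ℕ → ℕ) {h h' : ZState} (hm : ZMove h h') :
    ∃ a b, zW w h' + a = zW w h + b ∧
      ((∃ j, a = w (j + 3) ∧ b = w (j + 2) + w (j + 1)) ∨
       (a = w 2 ∧ b = 2 * w 1) ∨
       (∃ j, a = w (j + 4) + w (j + 1) ∧ b = 2 * w (j + 3)) ∨
       (a = w 3 + w 1 ∧ b = 2 * w 2)) := by
  cases hm with
  | split i hi hpos =>
    obtain ⟨j, rfl⟩ : ∃ j, i = j + 2 := ⟨i - 2, by omega⟩
    refine ⟨_, _, ?_, Or.inl ⟨j, rfl, rfl⟩⟩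
    have := zW_sub w h _ hpos
    simp only [zW_add, zW_single, Nat.add_assoc, Nat.reduceAdd, show j + 2 - 1 = j + 1 by omega] at *
    omega
  | splitTwo hpos =>
    refine ⟨_, _, ?_, Or.inr (Or.inl ⟨rfl, rfl⟩)⟩
    have := zW_sub w h _ hpos
    simp only [zW_add, zW_single] at *
    omega
  | combine i hi h1 h2 =>
    obtain ⟨j, rfl⟩ : ∃ j, i = j + 3 := ⟨i - 3, by omega⟩
    refine ⟨_, _, ?_, Or.inr (Or.inr (Or.inl ⟨j, rfl, rfl⟩))⟩
    simp only [show j + 3 - 2 = j + 1 by omega] at *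
    have e1 := zW_sub w h _ h1
    have e2 := zW_sub w (h - Finsupp.single (j + 3 + 1) 1) (j + 1) (by
      simpa [Finsupp.single_apply] using h2)
    simp only [zW_add, zW_single, Nat.add_assoc, Nat.reduceAdd] at *
    omega
  | combineTwo h1 h2 =>
    refine ⟨_, _, ?_, Or.inr (Or.inr (Or.inr ⟨rfl, rfl⟩))⟩
    have e1 := zW_sub w h _ h1
    have e2 := zW_sub w (h - Finsupp.single 3 1) 1 (by
      simpa [Finsupp.single_apply] using h2)
    simp only [zW_add, zW_single] at *
    omega

theorem zmove_decr {h h' : ZState} (hm : ZMove h h') :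
    zW (fun i => 3 ^ i) h' < zW (fun i => 3 ^ i) h := by
  obtain ⟨a, b, e, ⟨j, ha, hb⟩ | ⟨ha, hb⟩ | ⟨j, ha, hb⟩ | ⟨ha, hb⟩⟩ :=
    zmove_weight (fun i => 3 ^ i) hm
  · have := Nat.pow_pos (n := j) (show 0 < 3 by norm_num)
    simp only [pow_add] at ha hb
    omega
  · omega
  · have := Nat.pow_pos (n := j) (show 0 < 3 by norm_num)
    simp only [pow_add] at ha hb
    omega
  · omega

theorem zmove_value {h h' : ZState} (hm : ZMove h h') : zW zfib h' = zW zfib h := by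
  obtain ⟨a, b, e, ⟨j, ha, hb⟩ | ⟨ha, hb⟩ | ⟨j, ha, hb⟩ | ⟨ha, hb⟩⟩ :=
    zmove_weight zfib hm
  · have := Nat.fib_add_two (n := j + 2)
    simp only [zfib, Nat.add_assoc, Nat.reduceAdd] at *
    omega
  · norm_num [zfib, Nat.fib_add_two] at ha hb
    omega
  · have h1 := Nat.fib_add_two (n := j + 2)
    have h2 := Nat.fib_add_two (n := j + 3)
    simp only [zfib, Nat.add_assoc, Nat.reduceAdd] at *
    omega
  · norm_num [zfib, Nat.fib_add_two] at ha hb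
    omega

theorem zmove_zero {h h' : ZState} (hm : ZMove h h') (h0 : h 0 = 0) : h' 0 = 0 := by
  cases hm with
  | split i hi hpos =>
    have a : i ≠ 0 := by omega
    have b : i - 1 ≠ 0 := by omega
    simp [Finsupp.single_apply, h0, a, b]
  | splitTwo hpos => simp [h0]
  | combine i hi h1 h2 =>
    have a : i ≠ 0 := by omega
    simp [Finsupp.single_apply, h0, a]
  | combineTwo h1 h2 => simp [h0]

theorem zterminal {h : ZState} (h0 : h 0 = 0) (ht : ∀ h', ¬ ZMove h h') :
    h = Finsupp.single 1 (zW zfib h) := by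
  have key : h = Finsupp.single 1 (h 1) := by
    ext i
    match i with
    | 0 => simp [h0]
    | 1 => simp
    | 2 =>
      by_contra hc
      simp at hc
      exact ht _ (ZMove.splitTwo h (by omega))
    | j + 3 =>
      by_contra hc
      simp [Finsupp.single_apply] at hc
      exact ht _ (ZMove.split h (j + 2) (by omega) (Nat.pos_of_ne_zero hc))
  have e : zW zfib h = h 1 := by
    conv_lhs => rw [key]
    rw [zW_single]; simp [zfib]
  rw [e]; exact key

theorem zplay (n : ℕ) (l : List ZState) : ∀ z : ZState, z 0 = 0 → zW zfib z = n →
    IsCompletePlay z l → l.getLast? = some (Finsupp.single 1 n) := by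
  induction l with
  | nil => intro z _ _ h; simp [IsCompletePlay] at h
  | cons a t ih =>
    rintro z h0 hv ⟨hh, hc, hl⟩
    obtain rfl : a = z := by simpa using hh
    cases t with
    | nil =>
      have := zterminal h0 (hl a (by simp))
      rw [hv] at this
      simpa using this
    | cons b t =>
      obtain ⟨hm, hc'⟩ := List.isChain_cons_cons.1 hc
      rw [List.getLast?_cons_cons] at hl ⊢
      exact ih b (zmove_zero hm h0) ((zmove_value hm).trans hv) ⟨by simp, hc', hl⟩

/-- Every sequence of legal moves from the Zeckendorf decomposition of `n` is finite,
and every complete play of the reversed Zeckendorf game on `n` ends at the state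
with `n` chips in bin `1` and all other bins empty. -/
theorem reversedZeckendorf_terminates (n : ℕ) (hn : 0 < n)
    (z : ZState) (hz : IsZeckendorf n z) :
    (¬ ∃ f : ℕ → ZState, f 0 = z ∧ ∀ k, ZMove (f k) (f (k + 1))) ∧
    (∀ l : List ZState, IsCompletePlay z l → l.getLast? = some (Finsupp.single 1 n)) := by
  refine ⟨?_, fun l hl => zplay n l z hz.1 hz.2.2.2 hl⟩
  rintro ⟨f, -, hf⟩
  have : ∀ k, zW (fun i => 3 ^ i) (f k) + k ≤ zW (fun i => 3 ^ i) (f 0) := by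
    intro k
    induction k with
    | zero => simp
    | succ k ih => have := zmove_decr (hf k); omega
  have := this (zW (fun i => 3 ^ i) (f 0) + 1)
  omega
end

section
/- For every positive integer n, the minimum length of a complete play of the reversed Zeckendorf game on n equals n − Z(n): every complete play has length at least n − Z(n), and some complete play has length exactly n − Z(n). -/
def zval (h : ZState) : ℕ := h.sum fun i v => v * zfib i
def zcnt (h : ZState) : ℕ := h.sum fun _ v => v

lemma zval_add (a b : ZState) : zval (a + b) = zval a + zval b :=
  Finsupp.sum_add_index' (by simp) (by intros; ring)

lemma zcnt_add (a b : ZState) : zcnt (a + b) = zcnt a + zcnt b :=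
  Finsupp.sum_add_index' (by simp) (by intros; ring)

lemma zval_single (i v : ℕ) : zval (Finsupp.single i v) = v * zfib i :=
  Finsupp.sum_single_index (by simp)

lemma zcnt_single (i v : ℕ) : zcnt (Finsupp.single i v) = v :=
  Finsupp.sum_single_index (by simp)

lemma zpeel (h : ZState) (i : ℕ) (hi : 0 < h i) :
    ∃ g : ZState, h = g + Finsupp.single i 1 := by
  refine ⟨h - Finsupp.single i 1, (tsub_add_cancel_of_le ?_).symm⟩
  rw [Finsupp.single_le_iff]; exact hi

lemma zfib_rec (i : ℕ) : zfib (i + 2) = zfib (i + 1) + zfib i := by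
  unfold zfib; rw [Nat.fib_add_two (n := i + 1)]; ring

lemma zfib_pos (i : ℕ) : 0 < zfib i := Nat.fib_pos.2 (by omega)

lemma zcnt_le_zval (h : ZState) : zcnt h ≤ zval h := by
  unfold zcnt zval Finsupp.sum
  exact Finset.sum_le_sum fun i _ => Nat.le_mul_of_pos_right _ (zfib_pos i)

lemma zsplit_aux (h : ZState) (i : ℕ) (hi : 2 ≤ i) (hp : 0 < h i) :
    ∃ h', ZMove h h' ∧ zcnt h' = zcnt h + 1 := by
  rcases Nat.lt_or_ge 2 i with h2 | h2
  · obtain ⟨j, rfl⟩ : ∃ j, i = j + 1 := ⟨i - 1, by omega⟩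
    refine ⟨_, ZMove.split h j (by omega) hp, ?_⟩
    obtain ⟨g, rfl⟩ := zpeel h _ hp
    simp only [add_tsub_cancel_right, zcnt_add, zcnt_single]
  · obtain rfl : i = 2 := by omega
    refine ⟨_, ZMove.splitTwo h hp, ?_⟩
    obtain ⟨g, rfl⟩ := zpeel h _ hp
    simp only [add_tsub_cancel_right, zcnt_add, zcnt_single]

lemma zmove_inv {h h' : ZState} (m : ZMove h h') (h0 : h 0 = 0) :
    h' 0 = 0 ∧ zval h' = zval h ∧ zcnt h' ≤ zcnt h + 1 := by
  have f1 : zfib 1 = 1 := rfl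
  have f2 : zfib 2 = 2 := rfl
  have f3 : zfib 3 = 3 := rfl
  cases m with
  | split i hi hpos =>
    obtain ⟨g, rfl⟩ := zpeel h _ hpos
    obtain ⟨j, rfl⟩ : ∃ j, i = j + 1 + 1 := ⟨i - 2, by omega⟩
    have := zfib_rec (j + 1)
    simp only [add_tsub_cancel_right, zcnt_add, zcnt_single, zval_add, zval_single]
    refine ⟨by simpa using h0, ?_, by omega⟩
    simp only [add_assoc, Nat.reduceAdd] at *
    omega
  | splitTwo hpos =>
    obtain ⟨g, rfl⟩ := zpeel h _ hpos
    simp only [add_tsub_cancel_right, zcnt_add, zcnt_single, zval_add, zval_single]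
    exact ⟨by simpa using h0, by omega, by omega⟩
  | combine i hi h1 h2 =>
    obtain ⟨g, rfl⟩ := zpeel h _ h1
    have h2' : 0 < g (i - 2) := by
      simpa [Finsupp.single_apply, show i + 1 ≠ i - 2 by omega] using h2
    obtain ⟨g, rfl⟩ := zpeel g _ h2'
    obtain ⟨j, rfl⟩ : ∃ j, i = j + 2 := ⟨i - 2, by omega⟩
    have e1 := zfib_rec (j + 1)
    have e2 := zfib_rec j
    simp only [add_tsub_cancel_right, zcnt_add, zcnt_single, zval_add, zval_single]
    refine ⟨?_, ?_, by omega⟩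
    · simp at h0 ⊢; exact h0.1
    · simp only [add_assoc, Nat.reduceAdd] at *
      omega
  | combineTwo h1 h2 =>
    obtain ⟨g, rfl⟩ := zpeel h _ h1
    have h2' : 0 < g 1 := by simpa [Finsupp.single_apply] using h2
    obtain ⟨g, rfl⟩ := zpeel g _ h2'
    simp only [add_tsub_cancel_right, zcnt_add, zcnt_single, zval_add, zval_single]
    exact ⟨by simpa using h0, by omega, by omega⟩

lemma zterm {h : ZState} (h0 : h 0 = 0) (ht : ∀ i, 2 ≤ i → h i = 0) :
    zval h = zcnt h ∧ ∀ h', ¬ ZMove h h' := by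
  constructor
  · have e : h = Finsupp.single 1 (h 1) := by
      ext i
      rcases i with _ | _ | i
      · simpa using h0
      · simp
      · simpa [Finsupp.single_apply] using ht (i + 2) (by omega)
    rw [e, zval_single, zcnt_single]
    simp [zfib]
  · intro h' m
    cases m with
    | split i hi hpos => have := ht (i + 1) (by omega); omega
    | splitTwo hpos => have := ht 2 (by omega); omega
    | combine i hi h1 h2 => have := ht (i + 1) (by omega); omega
    | combineTwo h1 h2 => have := ht 3 (by omega); omega

lemma zlower : ∀ (l : List ZState) (h : ZState), IsCompletePlay h l → h 0 = 0 →
    zval h + 1 ≤ zcnt h + l.length := by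
  intro l
  induction l with
  | nil => intro h hp; simp [IsCompletePlay] at hp
  | cons a t ih =>
    intro h ⟨hh, hc, hl⟩ h0
    obtain rfl : a = h := by simpa using hh
    rcases t with _ | ⟨b, t⟩
    · have ht : ∀ i, 2 ≤ i → a i = 0 := by
        intro i hi
        by_contra hne
        obtain ⟨h', m, _⟩ := zsplit_aux a i hi (Nat.pos_of_ne_zero hne)
        exact hl a (by simp) h' m
      have := (zterm h0 ht).1
      simp; omega
    · have hc2 := List.isChain_cons_cons.1 hc
      obtain ⟨b0, bv, bc⟩ := zmove_inv hc2.1 h0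
      have := ih b ⟨rfl, hc2.2, by simpa [List.getLast?_cons_cons] using hl⟩ b0
      simp only [List.length_cons] at this ⊢
      omega

lemma zupper : ∀ (k : ℕ) (h : ZState), h 0 = 0 → zval h = zcnt h + k →
    ∃ l, IsCompletePlay h l ∧ l.length = k + 1 := by
  intro k
  induction k with
  | zero =>
    intro h h0 hk
    refine ⟨[h], ⟨rfl, List.isChain_singleton _, ?_⟩, rfl⟩
    have ht : ∀ i, 2 ≤ i → h i = 0 := by
      intro i hi
      by_contra hne
      obtain ⟨h', m, e⟩ := zsplit_aux h i hi (Nat.pos_of_ne_zero hne)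
      have := (zmove_inv m h0).2.1
      have := zcnt_le_zval h'
      omega
    intro x hx
    obtain rfl : h = x := by simpa using hx
    exact (zterm h0 ht).2
  | succ k ih =>
    intro h h0 hk
    have : ∃ i, 2 ≤ i ∧ 0 < h i := by
      by_contra hne
      push Not at hne
      have := (zterm h0 (fun i hi => Nat.le_zero.1 (hne i hi))).1
      omega
    obtain ⟨i, hi, hp⟩ := this
    obtain ⟨h', m, e⟩ := zsplit_aux h i hi hp
    obtain ⟨z0, zv, _⟩ := zmove_inv m h0
    obtain ⟨l, ⟨hh, hc, hl⟩, hlen⟩ := ih h' z0 (by omega)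
    rcases l with _ | ⟨b, t⟩
    · simp at hh
    obtain rfl : b = h' := by simpa using hh
    refine ⟨h :: b :: t, ⟨rfl, List.isChain_cons_cons.2 ⟨m, hc⟩, ?_⟩, by simpa using hlen⟩
    simpa [List.getLast?_cons_cons] using hl

/-- The minimum length of a complete play of the reversed Zeckendorf game on `n`
is `n - Z(n)`, where `Z(n)` is the number of summands in the Zeckendorf
decomposition of `n`. -/
theorem reversedZeckendorf_shortest_game (n : ℕ) (hn : 0 < n)
    (z : ZState) (hz : IsZeckendorf n z) :
    (∀ l : List ZState, IsCompletePlay z l → n - (z.sum fun _ v => v) ≤ l.length - 1) ∧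
    (∃ l : List ZState, IsCompletePlay z l ∧ l.length - 1 = n - (z.sum fun _ v => v)) := by
  obtain ⟨z0, -, -, hv⟩ := hz
  change zval z = n at hv
  change (∀ l : List ZState, IsCompletePlay z l → n - zcnt z ≤ l.length - 1) ∧
    (∃ l : List ZState, IsCompletePlay z l ∧ l.length - 1 = n - zcnt z)
  have hle := zcnt_le_zval z
  constructor
  · intro l hl
    have := zlower l z hl z0
    omega
  · obtain ⟨l, hl, e⟩ := zupper (n - zcnt z) z z0 (by omega)
    exact ⟨l, hl, by omega⟩
end

section
/- For every positive integer n, every complete play of the reversed Zeckendorf game on n has length at most ⌊φ²·n − Z_I(n) − 2·Z(n) + φ − 1⌋, where φ = (1+√5)/2 is the golden ratio. -/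
def zq : ℕ → ℕ
  | 0 => 0
  | 1 => 0
  | (i + 2) => zq (i + 1) + zq i + (i + 1)

def zQ (h : ZState) : ℕ := h.sum fun i v => v * zq i

lemma zQ_add (a b : ZState) : zQ (a + b) = zQ a + zQ b := by
  unfold zQ
  exact Finsupp.sum_add_index' (by simp) (by intros; ring)

lemma zQ_single (a b : ℕ) : zQ (Finsupp.single a b) = b * zq a := by
  unfold zQ
  exact Finsupp.sum_single_index (by simp)

lemma zsub1 (h : ZState) (a : ℕ) (ha : 0 < h a) :
    zQ (h - Finsupp.single a 1) + zq a = zQ h := by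
  have h1 : h - Finsupp.single a 1 + Finsupp.single a 1 = h := by
    apply tsub_add_cancel_of_le
    rw [Finsupp.single_le_iff]; exact ha
  have h2 := congrArg zQ h1
  rw [zQ_add, zQ_single] at h2
  omega

lemma zsub2 (h : ZState) (a b : ℕ) (hab : a ≠ b) (ha : 0 < h a) (hb : 0 < h b) :
    zQ (h - Finsupp.single a 1 - Finsupp.single b 1) + zq a + zq b = zQ h := by
  have h1 := zsub1 h a ha
  have h2 := zsub1 (h - Finsupp.single a 1) b (by simp [hab, hb])
  omega

lemma zQ_move (h h' : ZState) (m : ZMove h h') : zQ h' + 1 ≤ zQ h := by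
  cases m with
  | split i hi hpos =>
    have h1 := zsub1 h _ hpos
    obtain ⟨j, rfl⟩ : ∃ j, i = j + 1 := ⟨i - 1, by omega⟩
    simp only [zQ_add, zQ_single, Nat.add_sub_cancel]
    simp only [zq] at h1
    omega
  | splitTwo hpos =>
    have h1 := zsub1 h _ hpos
    simp only [zQ_add, zQ_single]
    simp only [zq] at h1 ⊢
    omega
  | combine i hi h1 h2 =>
    obtain ⟨j, rfl⟩ : ∃ j, i = j + 2 := ⟨i - 2, by omega⟩
    have h3 := zsub2 h _ _ (by omega) h1 h2
    simp only [zQ_add, zQ_single, Nat.add_sub_cancel] at h3 ⊢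
    simp only [zq] at h3 ⊢
    omega
  | combineTwo h1 h2 =>
    have h3 := zsub2 h _ _ (by omega) h1 h2
    simp only [zQ_add, zQ_single] at h3 ⊢
    simp only [zq] at h3 ⊢
    omega

lemma zQ_chain (l : List ZState) : ∀ z, (z :: l).IsChain ZMove → l.length ≤ zQ z := by
  induction l with
  | nil => intro z _; simp
  | cons a l ih =>
    intro z hc
    rw [List.isChain_cons_cons] at hc
    have h1 := ih a hc.2
    have h2 := zQ_move _ _ hc.1
    simp only [List.length_cons]
    omega

lemma zq_closed (φ ψ : ℝ) (h1 : φ + ψ = 1) (hφ : φ ^ 2 = φ + 1) (hψ : ψ ^ 2 = ψ + 1) (i : ℕ) :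
    (zq i : ℝ) = φ ^ 2 * zfib i - i - 2 + ψ ^ (i + 1) ∧
    (zq (i + 1) : ℝ) = φ ^ 2 * zfib (i + 1) - (i + 1 : ℕ) - 2 + ψ ^ (i + 2) := by
  induction i with
  | zero =>
    simp only [zq, zfib]
    norm_num
    constructor <;> linarith
  | succ i ih =>
    refine ⟨ih.2, ?_⟩
    have hf : zfib (i + 1 + 1) = zfib i + zfib (i + 1) := by
      unfold zfib; exact Nat.fib_add_two
    rw [hf]
    simp only [zq]
    push_cast at ih ⊢
    rw [ih.1, ih.2]
    have : ψ ^ (i + 1 + 2) = ψ ^ (i + 1) * (ψ + 1) := by rw [pow_add, hψ]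
    rw [this]
    ring

lemma zpsi_bound (ψ : ℝ) (hn : ψ < 0) (hψ : ψ ^ 2 = ψ + 1) (z : ZState) (h0 : z 0 = 0)
    (h1 : ∀ i, z i ≤ 1) (m : ℕ) :
    ∑ i ∈ Finset.range (2 * m + 1), (z i : ℝ) * ψ ^ (i + 1) ≤ -ψ + ψ ^ (2 * m + 1) := by
  induction m with
  | zero => simp [h0]
  | succ m ih =>
    rw [show 2 * (m + 1) + 1 = 2 * m + 1 + 1 + 1 by ring, Finset.sum_range_succ,
      Finset.sum_range_succ]
    have e1 : (0 : ℝ) < ψ ^ (2 * m + 1 + 1) := Even.pow_pos ⟨m + 1, by ring⟩ hn.ne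
    have e2 : ψ ^ (2 * m + 1 + 1 + 1) < 0 := Odd.pow_neg ⟨m + 1, by ring⟩ hn
    have e3 : ψ ^ (2 * m + 1 + 1 + 1) = ψ ^ (2 * m + 1 + 1) + ψ ^ (2 * m + 1) := by
      rw [show ψ ^ (2 * m + 1 + 1 + 1) = ψ ^ (2 * m + 1) * ψ ^ 2 by ring, hψ]; ring
    have z1 : (z (2 * m + 1) : ℝ) ≤ 1 := by exact_mod_cast h1 _
    have z2 : (0 : ℝ) ≤ z (2 * m + 1 + 1) := by positivity
    have a1 := mul_le_mul_of_nonneg_right z1 e1.le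
    have a2 := mul_nonpos_of_nonneg_of_nonpos z2 e2.le
    linarith

/-- Every complete play of the reversed Zeckendorf game on `n` has length at most
`⌊φ²·n − Z_I(n) − 2·Z(n) + φ − 1⌋`, where `φ` is the golden ratio, `Z(n)` the
number of summands and `Z_I(n)` the sum of the indices of the summands in the
Zeckendorf decomposition of `n`. -/
theorem reversedZeckendorf_longest_game (n : ℕ) (hn : 0 < n)
    (z : ZState) (hz : IsZeckendorf n z)
    (l : List ZState) (hl : IsCompletePlay z l) :
    ((l.length : ℤ) - 1) ≤
      ⌊(((1 + Real.sqrt 5) / 2) ^ 2 * n - ((z.sum fun i v => i * v : ℕ) : ℝ)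
        - 2 * ((z.sum fun _ v => v : ℕ) : ℝ) + (1 + Real.sqrt 5) / 2 - 1 : ℝ)⌋ := by
  obtain ⟨z0, z1, -, hsum⟩ := hz
  obtain ⟨hh, hc, -⟩ := hl
  cases l with
  | nil => simp at hh
  | cons a l =>
  simp only [List.head?_cons, Option.some.injEq] at hh
  subst hh
  have hlen := zQ_chain l a hc
  rw [Int.le_floor]
  have hs : Real.sqrt 5 ^ 2 = 5 := Real.sq_sqrt (by norm_num)
  have hs1 : 1 < Real.sqrt 5 := by
    rw [Real.lt_sqrt] <;> norm_num
  generalize hφ' : (1 + Real.sqrt 5) / 2 = φ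
  obtain ⟨ψ, hψ'⟩ : ∃ ψ : ℝ, ψ = (1 - Real.sqrt 5) / 2 := ⟨_, rfl⟩
  have hφ : φ ^ 2 = φ + 1 := by rw [← hφ']; linarith
  have hψ : ψ ^ 2 = ψ + 1 := by rw [hψ']; linarith
  have hadd : φ + ψ = 1 := by rw [← hφ', hψ']; ring
  have hneg : ψ < 0 := by rw [hψ']; linarith
  obtain ⟨m, hm⟩ : ∃ m : ℕ, a.support ⊆ Finset.range (2 * m + 1) := by
    refine ⟨a.support.sup id, fun i hi => ?_⟩
    have : i ≤ a.support.sup id := Finset.le_sup (f := id) hi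
    simp only [Finset.mem_range]; omega
  have hb := zpsi_bound ψ hneg hψ a z0 z1 m
  have ho : ψ ^ (2 * m + 1) < 0 := Odd.pow_neg ⟨m, rfl⟩ hneg
  have hlen' : (l.length : ℝ) ≤ (zQ a : ℝ) := by exact_mod_cast hlen
  have key : (zQ a : ℝ) = φ ^ 2 * n - ((a.sum fun i v => i * v : ℕ) : ℝ)
      - 2 * ((a.sum fun _ v => v : ℕ) : ℝ)
      + ∑ i ∈ Finset.range (2 * m + 1), (a i : ℝ) * ψ ^ (i + 1) := by
    rw [← hsum]
    unfold zQ
    rw [Finsupp.sum_of_support_subset _ hm _ (by simp),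
      Finsupp.sum_of_support_subset _ hm _ (by simp),
      Finsupp.sum_of_support_subset _ hm _ (by simp),
      Finsupp.sum_of_support_subset _ hm _ (by simp)]
    push_cast
    rw [Finset.mul_sum, Finset.mul_sum, ← Finset.sum_sub_distrib, ← Finset.sum_sub_distrib,
      ← Finset.sum_add_distrib]
    refine Finset.sum_congr rfl fun i _ => ?_
    rw [(zq_closed φ ψ hadd hφ hψ i).1]
    ring
  have hL : ((((a :: l).length : ℤ) - 1 : ℤ) : ℝ) = (l.length : ℝ) := by
    simp
  rw [hL]
  linarith
end

section
/- For every integer Z ≥ 1 and every z ∈ {0, 1, …, Z−1}, the proportion of complete plays of the reversed Zeckendorf game on N whose length is congruent to z modulo Z (i.e., the number of such plays divided by the total number of complete plays on N) converges to 1/Z as N → ∞. -/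
namespace ZG

inductive Mv : Type
  | a : Mv
  | b : Mv
  | c : Mv
  | s : ℕ → Mv
  | d : ℕ → Mv
  deriving DecidableEq

noncomputable def pre : Mv → ZState
  | .a => Finsupp.single 1 2
  | .b => Finsupp.single 1 1 + Finsupp.single 2 1
  | .c => Finsupp.single 2 2
  | .s j => Finsupp.single (j+3) 1 + Finsupp.single (j+2) 1
  | .d j => Finsupp.single (j+3) 2

noncomputable def post : Mv → ZState
  | .a => Finsupp.single 2 1
  | .b => Finsupp.single 3 1
  | .c => Finsupp.single 3 1 + Finsupp.single 1 1
  | .s j => Finsupp.single (j+4) 1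
  | .d j => Finsupp.single (j+4) 1 + Finsupp.single (j+1) 1

def Run (h : ZState) : List Mv → ZState → Prop
  | [], z => h = z
  | x :: w, z => ∃ k, h = k + pre x ∧ Run (k + post x) w z

theorem run_append {h z : ZState} {u v : List Mv} :
    Run h (u ++ v) z ↔ ∃ g, Run h u g ∧ Run g v z := by
  induction u generalizing h with
  | nil => simp [Run]
  | cons x u ih =>
    simp only [List.cons_append, Run, ih]
    constructor
    · rintro ⟨k, hk, g, h1, h2⟩; exact ⟨g, ⟨k, hk, h1⟩, h2⟩
    · rintro ⟨g, ⟨k, hk, h1⟩, h2⟩; exact ⟨k, hk, g, h1, h2⟩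

theorem run_mono {h z : ZState} {w : List Mv} (k : ZState) (hr : Run h w z) :
    Run (h + k) w (z + k) := by
  induction w generalizing h with
  | nil => simp only [Run] at hr ⊢; rw [hr]
  | cons x w ih =>
    obtain ⟨m, hm, hr⟩ := hr
    refine ⟨m + k, by rw [hm]; abel, ?_⟩
    have := ih hr
    rwa [add_right_comm] at this

/-- linear functional -/
noncomputable def phi (wt : ℕ → ℕ) (h : ZState) : ℕ := h.sum fun i v => v * wt i

theorem phi_add (wt : ℕ → ℕ) (h k : ZState) : phi wt (h + k) = phi wt h + phi wt k := by
  unfold phi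
  exact Finsupp.sum_add_index' (by simp) (by intros; ring)

theorem phi_single (wt : ℕ → ℕ) (i v : ℕ) : phi wt (Finsupp.single i v) = v * wt i := by
  unfold phi
  simp [Finsupp.sum_single_index]

theorem run_upper (wt : ℕ → ℕ) (p q : Mv → ℕ)
    (hx : ∀ x, phi wt (post x) + p x ≤ phi wt (pre x) + q x) {h z : ZState} {w : List Mv}
    (hr : Run h w z) : phi wt z + (w.map p).sum ≤ phi wt h + (w.map q).sum := by
  induction w generalizing h with
  | nil => simp only [Run] at hr; simp [hr]
  | cons x w ih =>
    obtain ⟨k, hk, hr⟩ := hr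
    have h1 := ih hr
    have h2 := hx x
    rw [hk]
    rw [phi_add] at h1 ⊢
    simp only [List.map_cons, List.sum_cons]
    omega

theorem run_lower (wt : ℕ → ℕ) (p q : Mv → ℕ)
    (hx : ∀ x, phi wt (pre x) + p x ≤ phi wt (post x) + q x) {h z : ZState} {w : List Mv}
    (hr : Run h w z) : phi wt h + (w.map p).sum ≤ phi wt z + (w.map q).sum := by
  induction w generalizing h with
  | nil => simp only [Run] at hr; simp [hr]
  | cons x w ih =>
    obtain ⟨k, hk, hr⟩ := hr
    have h1 := ih hr
    have h2 := hx x
    rw [hk]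
    rw [phi_add] at h1 ⊢
    simp only [List.map_cons, List.sum_cons]
    omega

def na (w : List Mv) : ℕ := w.count .a
def ne (w : List Mv) : ℕ := w.count .b + w.count .c

theorem sum_ia (m n : ℕ) (w : List Mv) :
    (w.map fun x => if x = .a then m else n).sum + n * na w = m * na w + n * w.length := by
  induction w with
  | nil => simp [na]
  | cons x w ih =>
    simp only [na, List.map_cons, List.sum_cons, List.length_cons, List.count_cons] at *
    by_cases hx : x = .a
    · subst hx; simp; nlinarith
    · simp [hx]; nlinarith

theorem sum_const (n : ℕ) (w : List Mv) : (w.map fun _ => n).sum = n * w.length := by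
  simp [mul_comm]

theorem sum_ie (m n l : ℕ) (w : List Mv) :
    (w.map fun x => if x = .a then m else if x = .b ∨ x = .c then n else l).sum
      + l * na w + l * ne w = m * na w + n * ne w + l * w.length := by
  induction w with
  | nil => simp [na, ne]
  | cons x w ih =>
    simp only [na, ne, List.map_cons, List.sum_cons, List.length_cons, List.count_cons] at *
    cases x <;> simp <;> nlinarith

/-- weights -/
def uw : ℕ → ℕ
  | 0 => 0
  | 1 => 0
  | 2 => 5
  | (j+3) => 2 * Nat.fib j + j + 4

def uw' : ℕ → ℕ
  | 0 => 0
  | (j+1) => uw j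

theorem pot1 {h z : ZState} {w : List Mv} (hr : Run h w z) :
    phi uw z + w.length ≤ phi uw h + 6 * na w := by
  have := run_upper uw (fun x => if x = .a then 0 else 1) (fun x => if x = .a then 5 else 0) (by
    intro x
    cases x with
    | a => simp [pre, post, phi_add, phi_single, uw]
    | b => simp [pre, post, phi_add, phi_single, uw]
    | c => simp [pre, post, phi_add, phi_single, uw]
    | s j =>
      rcases j with _ | j
      · simp [pre, post, phi_add, phi_single, uw]
      · simp only [pre, post, phi_add, phi_single, uw]
        have := Nat.fib_add_two (n := j)
        simp; omega
    | d j =>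
      rcases j with _ | _ | j
      · simp [pre, post, phi_add, phi_single, uw]
      · simp [pre, post, phi_add, phi_single, uw]
      · simp only [pre, post, phi_add, phi_single, uw]
        have := Nat.fib_add_two (n := j)
        have := Nat.fib_add_two (n := j+1)
        simp [add_assoc] at *; omega) hr
  have h1 := sum_ia 0 1 w
  have h2 := sum_ia 5 0 w
  omega

theorem pot2 {h z : ZState} {w : List Mv} (hr : Run h w z) :
    phi uw' z + w.length ≤ phi uw' h + na w + 6 * ne w := by
  have := run_upper uw' (fun x => if x = .a then 0 else if x = .b ∨ x = .c then 0 else 1)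
    (fun x => if x = .a then 0 else if x = .b ∨ x = .c then 5 else 0) (by
    intro x
    cases x with
    | a => simp [pre, post, phi_add, phi_single, uw, uw']
    | b => simp [pre, post, phi_add, phi_single, uw, uw']
    | c => simp [pre, post, phi_add, phi_single, uw, uw']
    | s j =>
      rcases j with _ | _ | j
      · simp [pre, post, phi_add, phi_single, uw, uw']
      · simp [pre, post, phi_add, phi_single, uw, uw']
      · simp only [pre, post, phi_add, phi_single, uw, uw']
        have := Nat.fib_add_two (n := j)
        simp; omega
    | d j =>
      rcases j with _ | _ | _ | j
      · simp [pre, post, phi_add, phi_single, uw, uw']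
      · simp [pre, post, phi_add, phi_single, uw, uw']
      · simp [pre, post, phi_add, phi_single, uw, uw']
      · simp only [pre, post, phi_add, phi_single, uw, uw']
        have := Nat.fib_add_two (n := j)
        have := Nat.fib_add_two (n := j+1)
        simp [add_assoc] at *; omega) hr
  have h1 := sum_ie 0 0 1 w
  have h2 := sum_ie 0 5 0 w
  omega

theorem chips {h z : ZState} {w : List Mv} (hr : Run h w z) :
    phi (fun _ => 1) z + na w ≤ phi (fun _ => 1) h := by
  have := run_upper (fun _ => 1) (fun x => if x = .a then 1 else 0) (fun _ => 0) (by
    intro x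
    cases x <;> simp [pre, post, phi_add, phi_single]) hr
  have h1 := sum_ia 1 0 w
  have h2 := sum_const 0 w
  omega

theorem phi_coord (j : ℕ) (h : ZState) : phi (fun i => if i = j then 1 else 0) h = h j := by
  induction h using Finsupp.induction_linear with
  | zero => simp [phi]
  | add f g hf hg => rw [phi_add, hf, hg]; rfl
  | single i v => rw [phi_single, Finsupp.single_apply]; simp

theorem low1 {h z : ZState} {w : List Mv} (hr : Run h w z) :
    h 1 ≤ z 1 + 2 * w.length := by
  have := run_lower (fun i => if i = 1 then 1 else 0) (fun _ => 0) (fun _ => 2) (by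
    intro x
    cases x <;> simp [pre, post, phi_add, phi_single]) hr
  rw [phi_coord, phi_coord] at this
  have h2 := sum_const 0 w
  have h3 := sum_const 2 w
  omega

theorem low2 {h z : ZState} {w : List Mv} (hr : Run h w z) :
    h 2 + 3 * na w ≤ z 2 + 2 * w.length := by
  have := run_lower (fun i => if i = 2 then 1 else 0) (fun x => if x = .a then 1 else 0)
    (fun x => if x = .a then 0 else 2) (by
    intro x
    cases x with
    | s j => by_cases hj : j = 0 <;> simp [pre, post, phi_add, phi_single, hj]
    | _ => simp [pre, post, phi_add, phi_single]) hr
  rw [phi_coord, phi_coord] at this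
  have h2 := sum_ia 1 0 w
  have h3 := sum_ia 0 2 w
  omega

/-- slack lemma -/
theorem run_slack (j n : ℕ) {H g : ZState} {v : List Mv}
    (hr : Run (H + Finsupp.single j n) v g)
    (hs : ∀ v1 v2 g1, v = v1 ++ v2 → Run (H + Finsupp.single j n) v1 g1 → n + 2 ≤ g1 j) :
    ∃ g0, g = g0 + Finsupp.single j n ∧ Run H v g0 := by
  induction v generalizing H with
  | nil => exact ⟨H, hr.symm, rfl⟩
  | cons x v ih =>
    obtain ⟨k, hk, hr⟩ := hr
    have h0 := hs [] (x :: v) _ rfl rfl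
    have hpre : pre x ≤ H := by
      intro i
      by_cases hi : i = j
      · subst hi
        have : pre x i ≤ 2 := by
          cases x <;> simp only [pre, Finsupp.add_apply, Finsupp.single_apply] <;> split_ifs <;> omega
        simp at h0
        omega
      · have := DFunLike.congr_fun hk i
        simp [Finsupp.single_apply, Ne.symm hi] at this
        omega
    obtain ⟨m, rfl⟩ := exists_add_of_le hpre
    have hkm : k = m + Finsupp.single j n := by
      have : pre x + k = pre x + (m + Finsupp.single j n) := by rw [add_comm, ← hk]; abel
      exact add_left_cancel this
    subst hkm
    have e : m + Finsupp.single j n + post x = (m + post x) + Finsupp.single j n := by abel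
    rw [e] at hr
    obtain ⟨g0, hg, hr'⟩ := ih hr (by
      intro v1 v2 g1 hv hr1
      refine hs (x :: v1) v2 g1 (by rw [hv]; rfl) ⟨m + Finsupp.single j n, hk, ?_⟩
      rwa [e])
    exact ⟨g0, hg, m, by rw [add_comm], hr'⟩

theorem case1_legal {h z : ZState} {u v r : List Mv}
    (hr : Run h (u ++ .c :: (v ++ .a :: r)) z) (hl : 2 * (u.length + v.length) + 8 ≤ h 1) :
    Run h (u ++ .b :: (v ++ r)) z := by
  rw [run_append] at hr ⊢
  obtain ⟨g, hu, k, rfl, hr⟩ := hr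
  refine ⟨_, hu, ?_⟩
  have l1 := low1 hu
  simp [pre] at l1
  rw [run_append] at hr
  obtain ⟨g2, hv, m, rfl, hr⟩ := hr
  obtain ⟨k', rfl⟩ : ∃ k', k = k' + Finsupp.single 1 1 := by
    refine ⟨k - Finsupp.single 1 1, ?_⟩
    rw [tsub_add_cancel_of_le]
    rw [Finsupp.single_le_iff]; omega
  refine ⟨k' + Finsupp.single 2 1, ?_, ?_⟩
  · simp only [pre]
    rw [show (Finsupp.single 2 2 : ZState) = Finsupp.single 2 1 + Finsupp.single 2 1 by
      rw [← Finsupp.single_add]]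
    abel
  have e : k' + Finsupp.single 1 1 + post .c = (k' + Finsupp.single 3 1) + Finsupp.single 1 2 := by
    rw [show (Finsupp.single 1 2 : ZState) = Finsupp.single 1 1 + Finsupp.single 1 1 by
      rw [← Finsupp.single_add]]
    simp only [post]; abel
  rw [e] at hv
  obtain ⟨g0, hg, hv'⟩ := run_slack 1 2 hv (by
    intro v1 v2 g1 hv hr1
    have l2 := low1 hr1
    have l3 : v.length = v1.length + v2.length := by rw [hv]; simp
    simp at l2 l1
    omega)
  have hm : g0 = m := by
    simp only [pre] at hg
    exact (add_right_cancel hg).symm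
  subst hm
  rw [run_append]
  refine ⟨_, ?_, hr⟩
  have := run_mono (Finsupp.single 2 1) hv'
  have e3 : k' + Finsupp.single 2 1 + post .b = k' + Finsupp.single 3 1 + Finsupp.single 2 1 := by
    simp only [post]; abel
  rw [e3]
  exact this

theorem case2_pre {h z : ZState} {u v r : List Mv}
    (hr : Run h (u ++ (v ++ r)) z)
    (hs : ∀ v1 v2 g1, v = v1 ++ v2 → Run h (u ++ v1) g1 → 4 ≤ g1 2) :
    ∃ g, Run h (u ++ .c :: v) (g + Finsupp.single 3 1 + Finsupp.single 1 1) ∧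
      Run (g + Finsupp.single 2 2) r z := by
  rw [run_append] at hr
  obtain ⟨g, hu, hr⟩ := hr
  rw [run_append] at hr
  obtain ⟨g2, hv, hr⟩ := hr
  have h0 := hs [] v g rfl (by simpa using hu)
  obtain ⟨k, rfl⟩ : ∃ k, g = k + Finsupp.single 2 2 := by
    refine ⟨g - Finsupp.single 2 2, ?_⟩
    rw [tsub_add_cancel_of_le]
    rw [Finsupp.single_le_iff]; omega
  obtain ⟨g0, rfl, hv'⟩ := run_slack 2 2 hv (by
    intro v1 v2 g1 hv hr1
    exact hs v1 v2 g1 hv (run_append.2 ⟨_, hu, hr1⟩))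
  refine ⟨g0, ?_, hr⟩
  rw [run_append]
  refine ⟨_, hu, k, rfl, ?_⟩
  have := run_mono (post .c) hv'
  simp only [post, ← add_assoc] at this ⊢
  exact this

theorem case2_c {h z : ZState} {u v r : List Mv}
    (hr : Run h (u ++ (v ++ .c :: r)) z)
    (hs : ∀ v1 v2 g1, v = v1 ++ v2 → Run h (u ++ v1) g1 → 4 ≤ g1 2) :
    Run h ((u ++ .c :: v) ++ r) z := by
  obtain ⟨g, h1, k, hk, h2⟩ := case2_pre hr hs
  rw [run_append]
  have : g = k := add_right_cancel hk
  subst this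
  refine ⟨_, h1, ?_⟩
  simpa [post, ← add_assoc] using h2

theorem case2_b {h z : ZState} {u v r : List Mv}
    (hr : Run h (u ++ (v ++ .b :: r)) z)
    (hs : ∀ v1 v2 g1, v = v1 ++ v2 → Run h (u ++ v1) g1 → 4 ≤ g1 2) :
    Run h ((u ++ .c :: v) ++ .a :: r) z := by
  obtain ⟨g, h1, k, hk, h2⟩ := case2_pre hr hs
  rw [run_append]
  refine ⟨_, h1, ?_⟩
  have e2 : (Finsupp.single 2 2 : ZState) = Finsupp.single 2 1 + Finsupp.single 2 1 := by
      rw [← Finsupp.single_add]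
  have e1 : (Finsupp.single 1 2 : ZState) = Finsupp.single 1 1 + Finsupp.single 1 1 := by
      rw [← Finsupp.single_add]
  have hk' : g + Finsupp.single 2 1 = k + Finsupp.single 1 1 := by
    simp only [pre] at hk
    rw [e2, ← add_assoc, ← add_assoc] at hk
    exact add_right_cancel hk
  obtain ⟨m, rfl⟩ : ∃ m, g = m + Finsupp.single 1 1 := by
    refine ⟨g - Finsupp.single 1 1, ?_⟩
    rw [tsub_add_cancel_of_le]
    rw [Finsupp.single_le_iff]
    have := DFunLike.congr_fun hk' 1
    simp at this; omega
  have hk2 : k = m + Finsupp.single 2 1 := by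
    rw [add_right_comm] at hk'
    exact (add_right_cancel hk').symm
  subst hk2
  refine ⟨m + Finsupp.single 3 1, ?_, ?_⟩
  · simp only [pre]; rw [e1]; abel
  · convert h2 using 1
    simp only [post]; abel



/-! token parsing -/
noncomputable def parse : ZState → List Mv → List (Option Mv)
  | _, [] => []
  | h, .a :: .c :: l => none :: parse (h - pre .a + post .a - pre .c + post .c) l
  | h, .b :: l => if 2 ≤ h 1 then none :: parse (h - pre .b + post .b) l
      else some .b :: parse (h - pre .b + post .b) l
  | h, x :: l => some x :: parse (h - pre x + post x) l
termination_by _ l => l.length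

def ex : List (Option Mv) → List (List Mv)
  | [] => [[]]
  | some x :: s => (ex s).map (x :: ·)
  | none :: s => (ex s).map (.b :: ·) ++ (ex s).map (fun l => .a :: .c :: l)

theorem ex_sum (ω : ℂ) (s : List (Option Mv)) :
    ((ex s).map fun w => ω ^ w.length).sum =
      ω ^ s.length * (1 + ω) ^ (s.count none) := by
  induction s with
  | nil => simp [ex]
  | cons x s ih =>
    cases x with
    | some x =>
      have : ((ex s).map fun w => ω ^ (w.length + 1)).sum = ω * ((ex s).map fun w => ω ^ w.length).sum := by
        rw [← List.sum_map_mul_left]; simp [pow_succ, mul_comm]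
      simp only [ex, List.map_map, Function.comp_def, List.length_cons, this, ih]
      simp; ring
    | none =>
      have h1 : ((ex s).map fun w => ω ^ (w.length + 1)).sum = ω * ((ex s).map fun w => ω ^ w.length).sum := by
        rw [← List.sum_map_mul_left]; simp [pow_succ, mul_comm]
      have h2 : ((ex s).map fun w => ω ^ (w.length + 1 + 1)).sum = ω^2 * ((ex s).map fun w => ω ^ w.length).sum := by
        rw [← List.sum_map_mul_left]
        congr 1; apply List.map_congr_left; intro x _; ring
      simp only [ex, List.map_append, List.map_map, Function.comp_def, List.length_cons, h1, h2, ih,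
        List.sum_append]
      simp; ring

theorem ex_length (s : List (Option Mv)) : (ex s).length = 2 ^ (s.count none) := by
  induction s with
  | nil => simp [ex]
  | cons x s ih =>
    cases x with
    | some x => simp [ex, ih]
    | none => simp [ex, ih]; ring

theorem ex_nodup (s : List (Option Mv)) : (ex s).Nodup := by
  induction s with
  | nil => simp [ex]
  | cons x s ih =>
    cases x with
    | some x => exact ih.map (fun _ _ h => by simpa using h)
    | none =>
      refine List.Nodup.append (ih.map (fun _ _ h => by simpa using h))
        (ih.map (fun _ _ h => by simpa using h)) ?_
      intro x hx hy
      simp at hx hy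
      obtain ⟨_, _, rfl⟩ := hx
      obtain ⟨_, _, h⟩ := hy
      simp at h

theorem mem_ex_parse (h : ZState) (w : List Mv) : w ∈ ex (parse h w) := by
  induction h, w using parse.induct with
  | case1 => simp [parse, ex]
  | case2 h l ih => rw [parse]; simp [ex, ih]
  | case3 h l hh ih => rw [parse, if_pos hh]; simp [ex, ih]
  | case4 h l hh ih => rw [parse, if_neg hh]; simp [ex, ih]
  | case5 h x l h1 h2 ih =>
    rw [parse]
    · simp [ex, ih]
    · exact h1
    · exact h2

theorem ex_parse_head {h : ZState} {l w : List Mv} (hw : .c :: w ∈ ex (parse h l)) :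
    ∃ l', l = .c :: l' := by
  match l with
  | [] => simp [parse, ex] at hw
  | .a :: .c :: l => rw [parse] at hw; simp [ex] at hw
  | .b :: l => rw [parse] at hw; split_ifs at hw <;> simp [ex] at hw
  | .c :: l => exact ⟨l, rfl⟩
  | .s j :: l => rw [parse] at hw <;> first | (simp [ex] at hw; done) | simp
  | .d j :: l => rw [parse] at hw <;> first | (simp [ex] at hw; done) | simp
  | [.a] => rw [parse] at hw <;> first | (simp [ex] at hw; done) | simp
  | .a :: .a :: l => rw [parse] at hw <;> first | (simp [ex] at hw; done) | simp
  | .a :: .b :: l => rw [parse] at hw <;> first | (simp [ex] at hw; done) | simp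
  | .a :: .s j :: l => rw [parse] at hw <;> first | (simp [ex] at hw; done) | simp
  | .a :: .d j :: l => rw [parse] at hw <;> first | (simp [ex] at hw; done) | simp

theorem run_cons {h z : ZState} {x : Mv} {w : List Mv} :
    Run h (x :: w) z ↔ pre x ≤ h ∧ Run (h - pre x + post x) w z := by
  constructor
  · rintro ⟨k, rfl, h⟩
    exact ⟨by simp, by simpa using h⟩
  · rintro ⟨h1, h2⟩
    exact ⟨_, (tsub_add_cancel_of_le h1).symm, h2⟩

theorem swap_state {h : ZState} (h1 : 2 ≤ h 1) (h2 : 1 ≤ h 2) :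
    h - pre .a + post .a - pre .c + post .c = h - pre .b + post .b := by
  ext i
  have e1 := h1
  have e2 := h2
  simp only [pre, post, Finsupp.add_apply, Finsupp.tsub_apply, Finsupp.single_apply]
  split_ifs <;> subst_vars <;> omega

theorem ac_iff {h : ZState} : (pre .a ≤ h ∧ pre .c ≤ h - pre .a + post .a) ↔ 2 ≤ h 1 ∧ 1 ≤ h 2 := by
  simp only [pre, post, Finsupp.single_le_iff, Finsupp.add_apply, Finsupp.tsub_apply, Finsupp.single_apply]
  simp

theorem b_iff {h : ZState} : pre .b ≤ h ↔ 1 ≤ h 1 ∧ 1 ≤ h 2 := by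
  constructor
  · intro hh
    have h1 := hh 1
    have h2 := hh 2
    simp [pre] at h1 h2
    exact ⟨h1, h2⟩
  · rintro ⟨h1, h2⟩ i
    simp only [pre, Finsupp.add_apply, Finsupp.single_apply]
    split_ifs <;> subst_vars <;> omega

theorem parse_main {z : ZState} (h : ZState) (w0 : List Mv) :
    Run h w0 z → ∀ w ∈ ex (parse h w0), Run h w z ∧ parse h w = parse h w0 := by
  induction h, w0 using parse.induct with
  | case1 h => intro hr w hw; simp [parse, ex] at hw; subst hw; exact ⟨hr, rfl⟩
  | case2 h l ih =>
    intro hr w hw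
    rw [run_cons, run_cons, ← and_assoc] at hr
    obtain ⟨hl, hr⟩ := hr
    have hl' := ac_iff.1 hl
    rw [parse] at hw
    simp [ex] at hw
    rcases hw with ⟨w, hw, rfl⟩ | ⟨w, hw, rfl⟩
    · obtain ⟨i1, i2⟩ := ih hr w hw
      rw [run_cons, b_iff, ← swap_state hl'.1 hl'.2]
      refine ⟨⟨⟨by omega, hl'.2⟩, i1⟩, ?_⟩
      rw [parse, parse, if_pos hl'.1, ← swap_state hl'.1 hl'.2, i2]
    · obtain ⟨i1, i2⟩ := ih hr w hw
      rw [run_cons, run_cons, ← and_assoc]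
      exact ⟨⟨hl, i1⟩, by rw [parse, parse, i2]⟩
  | case3 h l hh ih =>
    intro hr w hw
    rw [run_cons, b_iff] at hr
    obtain ⟨hl, hr⟩ := hr
    rw [parse, if_pos hh] at hw
    simp [ex] at hw
    rcases hw with ⟨w, hw, rfl⟩ | ⟨w, hw, rfl⟩
    · obtain ⟨i1, i2⟩ := ih hr w hw
      rw [run_cons, b_iff]
      refine ⟨⟨hl, i1⟩, ?_⟩
      rw [parse, parse, if_pos hh, if_pos hh, i2]
    · obtain ⟨i1, i2⟩ := ih hr w hw
      rw [run_cons, run_cons, ← and_assoc, ac_iff, swap_state hh hl.2]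
      refine ⟨⟨⟨hh, hl.2⟩, i1⟩, ?_⟩
      rw [parse, parse, if_pos hh, swap_state hh hl.2, i2]
  | case4 h l hh ih =>
    intro hr w hw
    rw [run_cons] at hr
    obtain ⟨hl, hr⟩ := hr
    rw [parse, if_neg hh] at hw
    simp [ex] at hw
    obtain ⟨w, hw, rfl⟩ := hw
    obtain ⟨i1, i2⟩ := ih hr w hw
    rw [run_cons]
    exact ⟨⟨hl, i1⟩, by rw [parse, parse, if_neg hh, if_neg hh, i2]⟩
  | case5 h x l h1 h2 ih =>
    intro hr w hw
    rw [run_cons] at hr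
    obtain ⟨hl, hr⟩ := hr
    rw [parse] at hw
    rotate_left
    · exact h1
    · exact h2
    simp [ex] at hw
    obtain ⟨w, hw, rfl⟩ := hw
    obtain ⟨i1, i2⟩ := ih hr w hw
    rw [run_cons]
    refine ⟨⟨hl, i1⟩, ?_⟩
    rw [parse, parse, i2]
    · exact h1
    · exact h2
    · rintro w' rfl rfl
      obtain ⟨l', rfl⟩ := ex_parse_head hw
      exact h1 _ rfl rfl
    · exact h2

/-- number of tokens -/
noncomputable def tok (h : ZState) (w : List Mv) : ℕ := (parse h w).count none

theorem char_bound (h z : ZState) (P : Finset (List Mv)) (hP : ∀ w, w ∈ P ↔ Run h w z)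
    (ω : ℂ) (hω : ‖ω‖ = 1) :
    ‖∑ w ∈ P, ω ^ w.length‖ ≤ ∑ w ∈ P, (‖1 + ω‖ / 2) ^ (tok h w) := by
  classical
  have key : ∀ s ∈ P.image (parse h), (P.filter fun w => parse h w = s) = (ex s).toFinset := by
    intro s hs
    obtain ⟨w0, hw0, rfl⟩ := Finset.mem_image.1 hs
    ext w
    simp only [Finset.mem_filter, List.mem_toFinset]
    constructor
    · rintro ⟨_, h2⟩; rw [← h2]; exact mem_ex_parse h w
    · intro hw
      have := parse_main h w0 ((hP _).1 hw0) w hw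
      exact ⟨(hP _).2 this.1, this.2⟩
  have hmap : ∀ w ∈ P, parse h w ∈ P.image (parse h) := fun w hw => Finset.mem_image_of_mem _ hw
  rw [← Finset.sum_fiberwise_of_maps_to hmap, ← Finset.sum_fiberwise_of_maps_to hmap]
  refine (norm_sum_le _ _).trans (Finset.sum_le_sum ?_)
  intro s hs
  have e : ∑ w ∈ P.filter (fun w => parse h w = s), (‖1 + ω‖ / 2) ^ (tok h w) =
      ∑ w ∈ P.filter (fun w => parse h w = s), (‖1 + ω‖ / 2) ^ (s.count none) := by
    refine Finset.sum_congr rfl ?_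
    intro w hw
    rw [tok, (Finset.mem_filter.1 hw).2]
  rw [e, key s hs, Finset.sum_const, List.toFinset_card_of_nodup (ex_nodup s), ex_length,
    List.sum_toFinset _ (ex_nodup s), ex_sum]
  have h2 : (2:ℝ) ^ List.count none s ≠ 0 := by positivity
  simp [hω, div_pow]
  rw [mul_div_cancel₀ _ h2]

theorem tok_ge (h : ZState) (w : List Mv) : ∀ T, 2 * T ≤ h 1 → ∀ z, Run h w z →
    (w.take T).count .b ≤ tok h w := by
  unfold tok
  induction h, w using parse.induct with
  | case1 => simp
  | case2 h l ih =>
    intro T hT z hr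
    rw [parse]
    rw [run_cons, run_cons] at hr
    obtain ⟨_, _, hr⟩ := hr
    rcases T with _ | _ | T
    · simp
    · simp
    · have := ih T (by simp [pre, post]; omega) z hr
      simp; omega
  | case3 h l hh ih =>
    intro T hT z hr
    rw [parse, if_pos hh]
    rw [run_cons] at hr
    obtain ⟨_, hr⟩ := hr
    rcases T with _ | T
    · simp
    · have := ih T (by simp [pre, post]; omega) z hr
      simp; omega
  | case4 h l hh ih =>
    intro T hT z hr
    have : T = 0 := by omega
    simp [this]
  | case5 h x l h1 h2 ih =>
    intro T hT z hr
    rw [parse]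
    rotate_left
    · exact h1
    · exact h2
    rw [run_cons] at hr
    obtain ⟨hp, hr⟩ := hr
    rcases T with _ | T
    · simp
    · have hx : x ≠ .b := h2
      have h3 : pre x 1 ≤ 2 := by
        cases x <;> simp [pre]
      have := ih T (by simp; omega) z hr
      simp [List.count_cons, hx]; omega


theorem dbl {α β : Type*} (B P : Finset α) (f : α → β → α) (S R : α → Finset β) (n m : ℕ)
    (hS : ∀ w ∈ B, n ≤ (S w).card)
    (hR : ∀ w ∈ B, ∀ t ∈ S w, f w t ∈ P ∧ t ∈ R (f w t) ∧ (R (f w t)).card ≤ m)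
    (inj : ∀ w ∈ B, ∀ w' ∈ B, ∀ t, t ∈ S w → t ∈ S w' → f w t = f w' t → w = w') :
    B.card * n ≤ P.card * m := by
  classical
  have h1 : B.card * n ≤ (B.sigma S).card := by
    rw [Finset.card_sigma]
    exact Finset.card_nsmul_le_sum _ _ _ hS
  have h2 : ((P.filter fun w => (R w).card ≤ m).sigma R).card ≤ P.card * m := by
    rw [Finset.card_sigma]
    refine (Finset.sum_le_card_nsmul _ _ m ?_).trans ?_
    · intro x hx; exact (Finset.mem_filter.1 hx).2
    · rw [smul_eq_mul]; exact Nat.mul_le_mul_right _ (Finset.card_filter_le _ _)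
  refine h1.trans (le_trans ?_ h2)
  refine Finset.card_le_card_of_injOn (fun x => ⟨f x.1 x.2, x.2⟩) ?_ ?_
  · rintro ⟨w, t⟩ hx
    simp only [Finset.coe_sigma, Set.mem_sigma_iff, Finset.mem_coe] at hx
    have := hR w hx.1 t hx.2
    simp only [Finset.mem_coe, Finset.mem_sigma, Finset.mem_filter]
    exact ⟨⟨this.1, this.2.2⟩, this.2.1⟩
  · rintro ⟨w, t⟩ hx ⟨w', t'⟩ hx' he
    simp only [Finset.coe_sigma, Set.mem_sigma_iff, Finset.mem_coe] at hx hx'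
    simp only [Sigma.mk.injEq, heq_eq_eq] at he
    obtain ⟨e1, rfl⟩ := he
    have := inj w hx.1 w' hx'.1 t hx.2 hx'.2 e1
    subst this; rfl

def pos (w : List Mv) (n : ℕ) (x : Mv) : Finset ℕ :=
  (Finset.range n).filter fun i => w[i]? = some x

theorem card_pos (w : List Mv) (n : ℕ) (x : Mv) : (pos w n x).card = (w.take n).count x := by
  induction n with
  | zero => simp [pos]
  | succ n ih =>
    unfold pos at *
    rw [Finset.range_add_one, Finset.filter_insert, List.take_add_one, List.count_append, ← ih]
    rcases hx : w[n]? with _ | y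
    · simp
    · by_cases hxy : y = x
      · subst hxy
        simp
      · simp [hxy]

theorem mem_pos {w : List Mv} {n : ℕ} {x : Mv} {i : ℕ} :
    i ∈ pos w n x ↔ i < n ∧ w[i]? = some x := by simp [pos]

theorem dec1 {w : List Mv} {i : ℕ} {x : Mv} (h : w[i]? = some x) :
    w = w.take i ++ x :: w.drop (i+1) ∧ (w.take i).length = i := by
  obtain ⟨hi, rfl⟩ := List.getElem?_eq_some_iff.1 h
  refine ⟨by simp, by simp; omega⟩

theorem dec2 {w : List Mv} {i q : ℕ} {x y : Mv} (hiq : i < q) (h : w[i]? = some x)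
    (h2 : w[q]? = some y) :
    ∃ u v r, w = u ++ x :: (v ++ y :: r) ∧ u.length = i ∧ i + 1 + v.length = q ∧
      u = w.take i ∧ v = (w.take q).drop (i+1) ∧ r = w.drop (q+1) := by
  refine ⟨_, _, _, ?_, ?_, ?_, rfl, rfl, rfl⟩
  · have e1 := (dec1 h2).1
    have h' : (w.take q)[i]? = some x := by rw [List.getElem?_take, if_pos hiq]; exact h
    have e2 := (dec1 h').1
    rw [List.take_take, min_eq_left hiq.le] at e2
    conv_lhs => rw [e1, e2]
    simp
  · exact (dec1 h).2
  · obtain ⟨hq, _⟩ := List.getElem?_eq_some_iff.1 h2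
    simp; omega

theorem dec3 {w : List Mv} {i q : ℕ} {y : Mv} (hiq : i ≤ q) (h2 : w[q]? = some y) :
    ∃ u v r, w = u ++ (v ++ y :: r) ∧ u.length = i ∧ i + v.length = q ∧
      u = w.take i ∧ v = (w.take q).drop i ∧ r = w.drop (q+1) := by
  obtain ⟨hq, _⟩ := List.getElem?_eq_some_iff.1 h2
  refine ⟨_, _, _, ?_, ?_, ?_, rfl, rfl, rfl⟩
  · have e1 := (dec1 h2).1
    have e2 := (List.take_append_drop i (w.take q)).symm
    rw [List.take_take, min_eq_left hiq] at e2
    conv_lhs => rw [e1, e2]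
    simp
  · simp; omega
  · simp; omega

theorem len_lower {N : ℕ} {z : ZState} {w : List Mv} (hz : z 1 ≤ 1)
    (hr : Run (Finsupp.single 1 N) w z) : N ≤ 1 + 2 * w.length := by
  have := low1 hr
  simp at this; omega

theorem len_upper {N : ℕ} {z : ZState} {w : List Mv}
    (hr : Run (Finsupp.single 1 N) w z) : w.length ≤ 6 * N := by
  have h1 := pot1 hr
  have h2 := chips hr
  rw [phi_single] at h1 h2
  simp [uw] at h1 h2
  omega

theorem case1 (N M K X : ℕ) (z : ZState) (hz : z 1 ≤ 1) (hM : 24 * M + 8 ≤ N)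
    (P : Finset (List Mv)) (hP : ∀ w, w ∈ P ↔ Run (Finsupp.single 1 N) w z)
    (B : Finset (List Mv)) (hB : ∀ w ∈ B, w ∈ P ∧ (w.take (12*M)).count .b ≤ K ∧
      X ≤ (w.take M).count .c) :
    B.card * (X * M) ≤ P.card * ((K+1) * (12 * M)) := by
  classical
  refine dbl B P (fun w t => w.take t.1 ++ .b :: ((w.take t.2).drop (t.1+1) ++ w.drop (t.2+1)))
    (fun w => pos w M .c ×ˢ (pos w (12*M) .a \ pos w M .a))
    (fun w => pos w (12*M-1) .b ×ˢ Finset.range (12*M)) _ _ ?_ ?_ ?_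
  · intro w hw
    obtain ⟨hwP, hb, hc⟩ := hB w hw
    rw [Finset.card_product, card_pos]
    refine Nat.mul_le_mul hc ?_
    have hr := (hP w).1 hwP
    have hl := len_lower hz hr
    have h1 : (pos w M .a).card ≤ M := by
      refine (Finset.card_filter_le _ _).trans (by simp)
    have h2 : 2 * M ≤ (pos w (12*M) .a).card := by
      rw [card_pos]
      rw [← List.take_append_drop (12*M) w, run_append] at hr
      obtain ⟨g, hr, _⟩ := hr
      have := pot1 hr
      rw [phi_single] at this
      simp [uw, na] at this
      omega
    have := Finset.le_card_sdiff (pos w M .a) (pos w (12*M) .a)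
    omega
  · rintro w hw ⟨i, q⟩ ht
    obtain ⟨hwP, hb, hc⟩ := hB w hw
    simp only [Finset.mem_product, Finset.mem_sdiff, mem_pos] at ht
    obtain ⟨⟨hi, hic⟩, ⟨hq, hqa⟩, hq2⟩ := ht
    have hMq : M ≤ q := by
      by_contra hcon; exact hq2 ⟨by omega, hqa⟩
    obtain ⟨u, v, r, hwe, hu, hv, e1, e2, e3⟩ := dec2 (by omega) hic hqa
    simp only
    rw [← e1, ← e2, ← e3]
    refine ⟨?_, ?_, ?_⟩
    · rw [hP]
      refine case1_legal (hwe ▸ (hP w).1 hwP) ?_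
      simp; omega
    · simp only [Finset.mem_product, mem_pos, Finset.mem_range]
      refine ⟨⟨by omega, ?_⟩, hq⟩
      rw [← hu]; simp
    · rw [Finset.card_product, card_pos, Finset.card_range]
      refine Nat.mul_le_mul_right _ ?_
      obtain ⟨m, hm⟩ : ∃ m, 12 * M = u.length + (v.length + (m + 1) + 1) :=
        ⟨12*M - (q + 1), by omega⟩
      have hm' : 12 * M - 1 = u.length + (v.length + m + 1) := by omega
      rw [hwe, hm] at hb
      rw [hm']
      simp [List.take_length_add_append] at hb ⊢
      omega
  · rintro w hw w' hw' ⟨i, q⟩ ht ht' he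
    simp only [Finset.mem_product, Finset.mem_sdiff, mem_pos] at ht ht'
    obtain ⟨⟨hi, hic⟩, ⟨hq, hqa⟩, hq2⟩ := ht
    obtain ⟨⟨_, hic'⟩, ⟨_, hqa'⟩, _⟩ := ht'
    have hMq : M ≤ q := by
      by_contra hcon; exact hq2 ⟨by omega, hqa⟩
    obtain ⟨u, v, r, hwe, hu, hv, e1, e2, e3⟩ := dec2 (by omega) hic hqa
    obtain ⟨u', v', r', hwe', hu', hv', e1', e2', e3'⟩ := dec2 (by omega) hic' hqa'
    simp only at he
    rw [← e1, ← e2, ← e3, ← e1', ← e2', ← e3'] at he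
    obtain ⟨rfl, he2⟩ := List.append_inj he (by omega)
    obtain ⟨rfl, rfl⟩ := List.append_inj (List.cons.inj he2).2 (by omega)
    rw [hwe, hwe']

theorem case2 (N M K X X2 : ℕ) (z : ZState) (hz : z 1 ≤ 1) (hz2 : z 2 ≤ 1) (hM : 24 * M + 8 ≤ N)
    (hM0 : 18 * (X + K + X2) + 4 ≤ M)
    (P : Finset (List Mv)) (hP : ∀ w, w ∈ P ↔ Run (Finsupp.single 1 N) w z)
    (B : Finset (List Mv)) (hB : ∀ w ∈ B, w ∈ P ∧ (w.take (12*M)).count .b ≤ K ∧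
      (w.take M).count .c < X) :
    B.card * ((M - (18 * (X + K + X2) + 4)) * X2) ≤ P.card * (X * ((6*N) * 2)) := by
  classical
  set M0 := 18 * (X + K + X2) + 4 with hM0d
  let E : List Mv → Finset ℕ := fun w => (Finset.Ico M w.length).filter fun t =>
    (w[t]? = some .b ∨ w[t]? = some .c) ∧ ne (w.take t) < X + K + X2
  have tall : ∀ τ g, Run (Finsupp.single 1 N) τ g → τ.length ≤ g 2 + 18 * ne τ := by
    intro τ g hr
    have h1 := pot2 hr
    have h2 := low2 hr
    rw [phi_single] at h1
    simp [uw', uw] at h1 h2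
    omega
  refine dbl B P (fun w t => (w.take t.1 ++ .c :: (w.take t.2.1).drop t.1) ++
      (if t.2.2 = true then w.drop (t.2.1+1) else .a :: w.drop (t.2.1+1)))
    (fun w => Finset.Ico M0 M ×ˢ ((E w).image fun t => (t, decide (w[t]? = some .c))))
    (fun w => pos w M .c ×ˢ (Finset.range (6*N) ×ˢ (Finset.univ : Finset Bool))) _ _ ?_ ?_ ?_
  · intro w hw
    obtain ⟨hwP, hb, hc⟩ := hB w hw
    have hr := (hP w).1 hwP
    have hl := len_lower hz hr
    rw [Finset.card_product, Nat.card_Ico]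
    refine Nat.mul_le_mul_left _ ?_
    rw [Finset.card_image_of_injective _ (fun a b hab => (Prod.ext_iff.1 hab).1)]
    have htot : X + K + X2 ≤ ne w := by
      have := tall _ _ hr
      omega
    have hex : ∃ n, X + K + X2 ≤ ne (w.take n) := ⟨w.length, by simpa using htot⟩
    let n := Nat.find hex
    have hn1 : X + K + X2 ≤ ne (w.take n) := Nat.find_spec hex
    have hn2 : ∀ t < n, ne (w.take t) < X + K + X2 := fun t ht => by
      have := Nat.find_min hex ht; omega
    have hn3 : n ≤ w.length := Nat.find_min' hex (by simpa using htot)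
    have hsub : (pos w n .b ∪ pos w n .c) \ (pos w M .b ∪ pos w M .c) ⊆ E w := by
      intro t ht
      simp only [Finset.mem_sdiff, Finset.mem_union, mem_pos, not_or, not_and] at ht
      simp only [E, Finset.mem_filter, Finset.mem_Ico]
      rcases ht with ⟨⟨h1, h2⟩ | ⟨h1, h2⟩, h3, h4⟩
      · exact ⟨⟨by by_contra hcon; exact h3 (by omega) h2, by omega⟩, Or.inl h2, hn2 _ h1⟩
      · exact ⟨⟨by by_contra hcon; exact h4 (by omega) h2, by omega⟩, Or.inr h2, hn2 _ h1⟩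
    have c1 := Finset.card_le_card hsub
    have c2 := Finset.le_card_sdiff (pos w M .b ∪ pos w M .c) (pos w n .b ∪ pos w n .c)
    have c3 : (pos w n .b ∪ pos w n .c).card = ne (w.take n) := by
      rw [Finset.card_union_of_disjoint, card_pos, card_pos, ne]
      rw [Finset.disjoint_left]
      intro i hi hi'
      rw [mem_pos] at hi hi'
      have := hi.2.symm.trans hi'.2
      simp at this
    have c4 := Finset.card_union_le (pos w M .b) (pos w M .c)
    rw [card_pos, card_pos] at c4
    have c5 : (w.take M).count .b ≤ (w.take (12*M)).count .b :=
      (List.take_sublist_take_left (by omega)).count_le _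
    omega
  · rintro w hw ⟨s, t, o⟩ ht
    obtain ⟨hwP, hb, hc⟩ := hB w hw
    have hr := (hP w).1 hwP
    have hlu := len_upper hr
    simp only [Finset.mem_product, Finset.mem_Ico, Finset.mem_image, Prod.mk.injEq, E,
      Finset.mem_filter] at ht
    obtain ⟨⟨hs1, hs2⟩, t', ⟨⟨ht1, ht2⟩, htw, hne⟩, rfl, ho⟩ := ht
    have hcomm : ∀ y u v r, w = u ++ (v ++ y :: r) → u.length = s → s + v.length = t' →
        (∀ v1 v2 g1, v = v1 ++ v2 → Run (Finsupp.single 1 N) (u ++ v1) g1 → 4 ≤ g1 2) := by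
      intro y u v r hwe hu hv v1 v2 g1 hvv hr1
      have h1 := tall _ _ hr1
      have h2 : ne (u ++ v1) ≤ ne (w.take t') := by
        have hsub : (u ++ v1).Sublist (w.take t') := by
          rw [hwe, hvv]
          have : t' = u.length + (v1.length + v2.length) := by
            rw [hvv] at hv; simp at hv; omega
          rw [this]
          simp [List.take_length_add_append]
        have a1 := hsub.count_le .b
        have a2 := hsub.count_le .c
        unfold ne; omega
      simp at h1
      omega
    have hcount : ∀ y u v r r', w = u ++ (v ++ y :: r) → u.length = s → s + v.length = t' →
        t' ∈ Finset.range (6*N) ∧ s ∈ pos (u ++ .c :: v ++ r') M .c ∧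
        (pos (u ++ .c :: v ++ r') M .c).card ≤ X := by
      intro y u v r r' hwe hu hv
      refine ⟨by simp; omega, ?_, ?_⟩
      · rw [mem_pos]; refine ⟨hs2, ?_⟩
        rw [← hu]; simp
      · rw [card_pos]
        obtain ⟨m, hm⟩ : ∃ m, M = u.length + (m + 1) := ⟨M - (s+1), by omega⟩
        rw [hwe, hm] at hc
        rw [hm]
        rw [List.append_assoc, List.take_length_add_append] 
        rw [List.take_length_add_append, List.take_append_of_le_length (by omega)] at hc
        rw [List.cons_append, List.take_succ_cons, List.take_append_of_le_length (by omega)]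
        have : (v.take m).count .c ≤ (v.take (m+1)).count .c :=
          (List.take_sublist_take_left (by omega)).count_le _
        simp at hc ⊢
        omega
    have hcard : ∀ Q : Finset ℕ, Q.card ≤ X →
        (Q ×ˢ (Finset.range (6*N) ×ˢ (Finset.univ : Finset Bool))).card ≤ X * (6*N*2) := by
      intro Q hQ
      rw [Finset.card_product, Finset.card_product]
      simp
      exact Nat.mul_le_mul_right _ hQ
    rcases htw with htw | htw
    · obtain ⟨u, v, r, hwe, hu, hv, e1, e2, e3⟩ := dec3 (by omega : s ≤ t') htw
      have ho' : o = false := by rw [← ho, htw]; simp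
      subst ho'
      simp only [Bool.false_eq_true, if_false]
      rw [← e1, ← e2, ← e3]
      obtain ⟨k1, k2, k3⟩ := hcount _ u v r (.a :: r) hwe hu hv
      refine ⟨?_, ?_, hcard _ k3⟩
      · rw [hP]; exact case2_b (hwe ▸ hr) (hcomm _ u v r hwe hu hv)
      · simp only [Finset.mem_product]; exact ⟨k2, k1, Finset.mem_univ _⟩
    · obtain ⟨u, v, r, hwe, hu, hv, e1, e2, e3⟩ := dec3 (by omega : s ≤ t') htw
      have ho' : o = true := by rw [← ho, htw]; simp
      subst ho'
      simp only [if_true]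
      rw [← e1, ← e2, ← e3]
      obtain ⟨k1, k2, k3⟩ := hcount _ u v r r hwe hu hv
      refine ⟨?_, ?_, hcard _ k3⟩
      · rw [hP]; exact case2_c (hwe ▸ hr) (hcomm _ u v r hwe hu hv)
      · simp only [Finset.mem_product]; exact ⟨k2, k1, Finset.mem_univ _⟩
  · rintro w hw w' hw' ⟨s, t, o⟩ ht ht' he
    simp only [Finset.mem_product, Finset.mem_Ico, Finset.mem_image, Prod.mk.injEq, E,
      Finset.mem_filter] at ht ht'
    obtain ⟨⟨hs1, hs2⟩, _, ⟨⟨ht1, ht2⟩, htw, hne⟩, rfl, ho⟩ := ht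
    obtain ⟨_, t', ⟨⟨_, _⟩, htw', _⟩, rfl, ho'⟩ := ht'
    have hy : ∃ y : Mv, w[t']? = some y ∧ w'[t']? = some y := by
      rcases htw with h1 | h1 <;> rcases htw' with h2 | h2
      · exact ⟨_, h1, h2⟩
      · rw [h1] at ho; rw [h2] at ho'; simp at ho ho'; rw [ho] at ho'; simp at ho'
      · rw [h1] at ho; rw [h2] at ho'; simp at ho ho'; rw [ho] at ho'; simp at ho'
      · exact ⟨_, h1, h2⟩
    obtain ⟨y, hy1, hy2⟩ := hy
    obtain ⟨u, v, r, hwe, hu, hv, e1, e2, e3⟩ := dec3 (by omega : s ≤ t') hy1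
    obtain ⟨u', v', r', hwe', hu', hv', e1', e2', e3'⟩ := dec3 (by omega : s ≤ t') hy2
    simp only at he
    rw [← e1, ← e2, ← e3, ← e1', ← e2', ← e3', List.append_assoc, List.append_assoc] at he
    obtain ⟨rfl, he2⟩ := List.append_inj he (by omega)
    obtain ⟨rfl, he3⟩ := List.append_inj (List.cons.inj he2).2 (by omega)
    have : r = r' := by
      cases o <;> simpa using he3
    rw [hwe, hwe', this]

theorem rare (K n : ℕ) : ∃ N0, ∀ N ≥ N0, ∀ z : ZState, z 1 ≤ 1 → z 2 ≤ 1 →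
    ∀ P : Finset (List Mv), (∀ w, w ∈ P ↔ Run (Finsupp.single 1 N) w z) →
    (P.filter fun w => tok (Finsupp.single 1 N) w ≤ K).card * n ≤ 2 * P.card := by
  classical
  set X := 12 * (K+1) * n with hX
  set X2 := 5000 * X * n with hX2
  set M0 := 18 * (X + K + X2) + 4 with hM0
  refine ⟨100 * (2 * M0 + 1), ?_⟩
  intro N hN z hz hz2 P hP
  set M := N / 100 with hM
  have hMN : 100 * M ≤ N ∧ N < 100 * M + 100 := by omega
  have hMM : 2 * M0 ≤ M := by omega
  set B1 := P.filter fun w => (w.take (12*M)).count .b ≤ K ∧ X ≤ (w.take M).count .c with hB1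
  set B2 := P.filter fun w => (w.take (12*M)).count .b ≤ K ∧ (w.take M).count .c < X with hB2
  have h1 := case1 N M K X z hz (by omega) P hP B1 (by
    intro w hw; rw [hB1, Finset.mem_filter] at hw; exact hw)
  have h2 := case2 N M K X X2 z hz hz2 (by omega) (by omega) P hP B2 (by
    intro w hw; rw [hB2, Finset.mem_filter] at hw; exact hw)
  have hsub : (P.filter fun w => tok (Finsupp.single 1 N) w ≤ K) ⊆ B1 ∪ B2 := by
    intro w hw
    rw [Finset.mem_filter] at hw
    have := tok_ge (Finsupp.single 1 N) w (12*M) (by simp; omega) z ((hP w).1 hw.1)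
    rw [Finset.mem_union, hB1, hB2, Finset.mem_filter, Finset.mem_filter]
    rcases Nat.lt_or_ge ((w.take M).count .c) X with h | h
    · exact Or.inr ⟨hw.1, by omega, h⟩
    · exact Or.inl ⟨hw.1, by omega, h⟩
  have hc := (Finset.card_le_card hsub).trans (Finset.card_union_le _ _)
  have hMpos : 0 < M := by omega
  have k1 : B1.card * n ≤ P.card := by
    have : (12 * (K+1) * M) * (B1.card * n) ≤ (12 * (K+1) * M) * P.card := by
      rw [hX] at h1
      calc _ = B1.card * (12 * (K+1) * n * M) := by ring
        _ ≤ _ := h1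
        _ = _ := by ring
    exact Nat.le_of_mul_le_mul_left this (by positivity)
  have k2 : B2.card * n ≤ P.card := by
    rcases Nat.eq_zero_or_pos X with h0 | h0
    · have : B2 = ∅ := by rw [hB2, h0]; simp
      rw [this]; simp
    have : (2500 * X * M) * (B2.card * n) ≤ (2500 * X * M) * P.card := by
      have a1 : M ≤ 2 * (M - M0) := by omega
      calc (2500 * X * M) * (B2.card * n) ≤ (2500 * X * (2 * (M - M0))) * (B2.card * n) := by gcongr
        _ = B2.card * ((M - M0) * X2) := by rw [hX2]; ring
        _ ≤ P.card * (X * ((6*N) * 2)) := h2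
        _ ≤ P.card * (X * (2500 * M)) := by
          have : 6*N*2 ≤ 2500*M := by omega
          exact Nat.mul_le_mul_left _ (Nat.mul_le_mul_left _ this)
        _ = _ := by ring
    exact Nat.le_of_mul_le_mul_left this (by positivity)
  calc _ ≤ (B1.card + B2.card) * n := Nat.mul_le_mul_right _ hc
    _ ≤ _ := by rw [add_mul]; omega


theorem fin_moves (h : ZState) : {x : Mv | pre x ≤ h}.Finite := by
  obtain ⟨B, hB⟩ : ∃ B, ∀ i, h i ≠ 0 → i < B := by
    refine ⟨h.support.sup id + 1, fun i hi => ?_⟩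
    have := Finset.le_sup (f := id) (Finsupp.mem_support_iff.2 hi)
    simp only [id] at this; omega
  refine Set.Finite.subset (s := {.a, .b, .c} ∪ Mv.s '' Set.Iio B ∪ Mv.d '' Set.Iio B) ?_ ?_
  · exact ((Set.toFinite _).union ((Set.finite_Iio B).image _)).union ((Set.finite_Iio B).image _)
  · intro x hx
    cases x with
    | a => simp
    | b => simp
    | c => simp
    | s j =>
      have h1 := hx (j+3)
      simp [pre] at h1
      have := hB (j+3) (by omega)
      simp; omega
    | d j =>
      have h1 := hx (j+3)
      simp [pre] at h1
      have := hB (j+3) (by omega)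
      simp; omega

theorem fin_runs (n : ℕ) : ∀ h, {w : List Mv | w.length ≤ n ∧ ∃ z, Run h w z}.Finite := by
  induction n with
  | zero =>
    intro h
    refine Set.Finite.subset (Set.finite_singleton []) ?_
    rintro w ⟨hw, _⟩
    simpa using hw
  | succ n ih =>
    intro h
    refine Set.Finite.subset (s := {[]} ∪ ⋃ x ∈ {x : Mv | pre x ≤ h}, (x :: ·) ''
      {w : List Mv | w.length ≤ n ∧ ∃ z, Run (h - pre x + post x) w z}) ?_ ?_
    · refine (Set.finite_singleton _).union ((fin_moves h).biUnion ?_)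
      intro x _
      exact (ih _).image _
    · rintro w ⟨hw, z, hr⟩
      cases w with
      | nil => simp
      | cons x w =>
        rw [run_cons] at hr
        right
        simp only [Set.mem_iUnion]
        exact ⟨x, hr.1, w, ⟨by simpa using hw, z, hr.2⟩, rfl⟩

theorem fin_P (N : ℕ) (z : ZState) : {w : List Mv | Run (Finsupp.single 1 N) w z}.Finite :=
  (fin_runs (6*N) (Finsupp.single 1 N)).subset fun _ hw => ⟨len_upper hw, z, hw⟩

noncomputable def PP (N : ℕ) (z : ZState) : Finset (List Mv) := (fin_P N z).toFinset

theorem mem_PP (N : ℕ) (z : ZState) (w : List Mv) :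
    w ∈ PP N z ↔ Run (Finsupp.single 1 N) w z := by simp [PP]

/-! game order -/
def GRun (x : ZState) : List Mv → ZState → Prop
  | [], y => x = y
  | m :: w, y => ∃ k, x = k + post m ∧ GRun (k + pre m) w y

theorem grun_iff {x y : ZState} {w : List Mv} : GRun x w y ↔ Run y w.reverse x := by
  induction w generalizing x with
  | nil => simp [GRun, Run, eq_comm]
  | cons m w ih =>
    simp only [GRun, List.reverse_cons, run_append, Run, ih]
    constructor
    · rintro ⟨k, rfl, h⟩; exact ⟨_, h, k, rfl, rfl⟩
    · rintro ⟨_, h, k, rfl, rfl⟩; exact ⟨k, rfl, h⟩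

theorem zmove_iff {x y : ZState} : ZMove x y ↔ ∃ m k, x = k + post m ∧ y = k + pre m := by
  constructor
  · intro h
    cases h with
    | split i hi hpos =>
      obtain ⟨k, rfl⟩ : ∃ k, x = k + Finsupp.single (i+1) 1 :=
        ⟨x - Finsupp.single (i+1) 1, (tsub_add_cancel_of_le (by rw [Finsupp.single_le_iff]; omega)).symm⟩
      rcases hi.eq_or_lt with rfl | hi
      · exact ⟨.b, k, rfl, by simp [pre]; abel⟩
      · obtain ⟨j, rfl⟩ : ∃ j, i = j + 3 := ⟨i - 3, by omega⟩
        exact ⟨.s j, k, rfl, by simp [pre]; abel⟩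
    | splitTwo hpos =>
      obtain ⟨k, rfl⟩ : ∃ k, x = k + Finsupp.single 2 1 :=
        ⟨x - Finsupp.single 2 1, (tsub_add_cancel_of_le (by rw [Finsupp.single_le_iff]; omega)).symm⟩
      exact ⟨.a, k, rfl, by simp [pre]⟩
    | combine i hi h1 h2 =>
      obtain ⟨j, rfl⟩ : ∃ j, i = j + 3 := ⟨i - 3, by omega⟩
      obtain ⟨k, rfl⟩ : ∃ k, x = k + Finsupp.single (j+3+1) 1 :=
        ⟨x - Finsupp.single (j+3+1) 1, (tsub_add_cancel_of_le (by rw [Finsupp.single_le_iff]; omega)).symm⟩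
      simp at h2
      obtain ⟨k, rfl⟩ : ∃ k', k = k' + Finsupp.single (j+1) 1 :=
        ⟨k - Finsupp.single (j+1) 1, (tsub_add_cancel_of_le (by rw [Finsupp.single_le_iff]; omega)).symm⟩
      exact ⟨.d j, k, by simp [post]; abel, by simp [pre]⟩
    | combineTwo h1 h2 =>
      obtain ⟨k, rfl⟩ : ∃ k, x = k + Finsupp.single 3 1 :=
        ⟨x - Finsupp.single 3 1, (tsub_add_cancel_of_le (by rw [Finsupp.single_le_iff]; omega)).symm⟩
      simp at h2
      obtain ⟨k, rfl⟩ : ∃ k', k = k' + Finsupp.single 1 1 :=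
        ⟨k - Finsupp.single 1 1, (tsub_add_cancel_of_le (by rw [Finsupp.single_le_iff]; omega)).symm⟩
      exact ⟨.c, k, by simp [post]; abel, by simp [pre]⟩
  · rintro ⟨m, k, rfl, rfl⟩
    cases m with
    | a =>
      have := ZMove.splitTwo (k + post .a) (by simp [post])
      simpa [post, pre] using this
    | b =>
      have := ZMove.split (k + post .b) 2 le_rfl (by simp [post])
      convert this using 1
      simp [post, pre]; abel
    | c =>
      have := ZMove.combineTwo (k + post .c) (by simp [post]) (by simp [post])
      convert this using 1
      have e : k + post .c = k + Finsupp.single 1 1 + Finsupp.single 3 1 := by simp [post]; abel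
      rw [e]; simp [pre]
    | s j =>
      have := ZMove.split (k + post (.s j)) (j+3) (by omega) (by simp [post])
      convert this using 1
      simp [post, pre]; abel
    | d j =>
      have := ZMove.combine (k + post (.d j)) (j+3) (by omega) (by simp [post]) (by simp [post])
      convert this using 1
      have e : k + post (.d j) = k + Finsupp.single (j+1) 1 + Finsupp.single (j+3+1) 1 := by
        simp [post]; abel
      rw [e]; simp [pre]

theorem mv_unique {m m' : Mv} (h : post m + pre m' = post m' + pre m) : m = m' := by
  have ev : ∀ i, post m i + pre m' i = post m' i + pre m i := fun i => by
    have := DFunLike.congr_fun h i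
    simpa using this
  have e1 := ev 1
  have e2 := ev 2
  have e3 := ev 3
  cases m <;> cases m'
  case s.s j j' =>
    have f1 := ev (j+4); have f2 := ev (j'+4)
    simp [post, pre, Finsupp.single_apply] at f1 f2
    congr 1; split_ifs at f1 f2 <;> omega
  case d.d j j' =>
    have f1 := ev (j+4); have f2 := ev (j'+4)
    simp [post, pre, Finsupp.single_apply] at f1 f2
    congr 1; split_ifs at f1 f2 <;> omega
  case s.d j j' =>
    exfalso
    have f1 := ev (j+4); have f2 := ev (j'+4); have f3 := ev (j'+3); have f4 := ev (j+3)
    have f5 := ev (j+2)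
    simp [post, pre, Finsupp.single_apply] at f1 f2 f3 f4 f5
    split_ifs at f1 f2 f3 f4 f5 <;> omega
  case d.s j' j =>
    exfalso
    have f1 := ev (j+4); have f2 := ev (j'+4); have f3 := ev (j'+3); have f4 := ev (j+3)
    have f5 := ev (j+2)
    simp [post, pre, Finsupp.single_apply] at f1 f2 f3 f4 f5
    split_ifs at f1 f2 f3 f4 f5 <;> omega
  all_goals first
    | rfl
    | (exfalso; simp [post, pre, Finsupp.single_apply] at e1 e2 e3; done)
    | (exfalso; simp [post, pre, Finsupp.single_apply] at e1 e2 e3; omega)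
    | (rename_i j; exfalso; have f1 := ev (j+4)
       simp [post, pre, Finsupp.single_apply] at f1; done)
    | (rename_i j; exfalso; have f1 := ev (j+4)
       simp [post, pre, Finsupp.single_apply] at f1; omega)

noncomputable def toPlay : ZState → List Mv → List ZState
  | x, [] => [x]
  | x, m :: w => x :: toPlay (x - post m + pre m) w

theorem toPlay_head (x : ZState) (w : List Mv) : ∃ l, toPlay x w = x :: l := by
  cases w <;> simp [toPlay]

theorem toPlay_length (x : ZState) (w : List Mv) : (toPlay x w).length = w.length + 1 := by
  induction w generalizing x with
  | nil => simp [toPlay]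
  | cons m w ih => simp [toPlay, ih]

theorem toPlay_ok {x y : ZState} {w : List Mv} (h : GRun x w y) :
    (toPlay x w).IsChain ZMove ∧ (toPlay x w).getLast? = some y := by
  induction w generalizing x with
  | nil => simp only [GRun] at h; simp [toPlay, h]
  | cons m w ih =>
    obtain ⟨k, rfl, h⟩ := h
    have := ih h
    obtain ⟨l, hl⟩ := toPlay_head (k + pre m) w
    simp only [toPlay, add_tsub_cancel_right]
    rw [hl] at this ⊢
    refine ⟨List.isChain_cons_cons.2 ⟨zmove_iff.2 ⟨m, k, rfl, rfl⟩, this.1⟩, ?_⟩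
    rw [List.getLast?_cons_cons]; exact this.2

theorem toPlay_inj {x y y' : ZState} {w w' : List Mv} (h : GRun x w y) (h' : GRun x w' y')
    (he : toPlay x w = toPlay x w') : w = w' := by
  induction w generalizing x w' with
  | nil =>
    have := congrArg List.length he
    rw [toPlay_length, toPlay_length] at this
    simp at this
    simp [this]
  | cons m w ih =>
    cases w' with
    | nil =>
      have := congrArg List.length he
      rw [toPlay_length, toPlay_length] at this
      simp at this
    | cons m' w' =>
      obtain ⟨k, rfl, h⟩ := h
      obtain ⟨k', hk, h'⟩ := h'
      simp only [toPlay, hk, add_tsub_cancel_right] at he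
      rw [← hk] at he
      simp only [add_tsub_cancel_right] at he
      have he := (List.cons.inj he).2
      obtain ⟨l, hl⟩ := toPlay_head (k + pre m) w
      obtain ⟨l', hl'⟩ := toPlay_head (k' + pre m') w'
      have e : k + pre m = k' + pre m' := by
        have := he; rw [hl, hl'] at this; exact (List.cons.inj this).1
      have hm : m = m' := by
        apply mv_unique
        have : (k + k') + (post m + pre m') = (k + k') + (post m' + pre m) := by
          calc _ = (k + post m) + (k' + pre m') := by abel
            _ = (k' + post m') + (k + pre m) := by rw [hk, e]
            _ = _ := by abel
        exact add_left_cancel this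
      subst hm
      have hkk : k = k' := add_right_cancel hk
      subst hkk
      rw [ih h h' he]

theorem toPlay_surj (l : List ZState) : ∀ x, l.head? = some x → l.IsChain ZMove →
    ∃ w y, GRun x w y ∧ toPlay x w = l := by
  induction l with
  | nil => simp
  | cons x' l ih =>
    intro x hx hc
    simp at hx; subst hx
    cases l with
    | nil => exact ⟨[], x', rfl, rfl⟩
    | cons x2 l =>
      rw [List.isChain_cons_cons] at hc
      obtain ⟨w, y, hw, he⟩ := ih x2 rfl hc.2
      obtain ⟨m, k, rfl, rfl⟩ := zmove_iff.1 hc.1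
      refine ⟨m :: w, y, ⟨k, rfl, hw⟩, ?_⟩
      simp [toPlay, he]

theorem terminal_iff {y : ZState} : (∀ h', ¬ ZMove y h') ↔ ∀ i, 2 ≤ i → y i = 0 := by
  constructor
  · intro h i hi
    by_contra hne
    rcases hi.eq_or_lt with rfl | hi
    · exact h _ (ZMove.splitTwo y (by omega))
    · obtain ⟨j, rfl⟩ : ∃ j, i = j + 1 := ⟨i - 1, by omega⟩
      exact h _ (ZMove.split y j (by omega) (by omega))
  · intro h h' hm
    obtain ⟨m, k, rfl, _⟩ := zmove_iff.1 hm
    cases m with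
    | a => have := h 2 (by omega); simp [post] at this
    | b => have := h 3 (by omega); simp [post] at this
    | c => have := h 3 (by omega); simp [post] at this
    | s j => have := h (j+4) (by omega); simp [post] at this
    | d j => have := h (j+4) (by omega); simp [post] at this

theorem val_mv (m : Mv) : phi zfib (pre m) = phi zfib (post m) := by
  cases m with
  | a => simp [pre, post, phi_single, zfib, Nat.fib_add_two]
  | b => simp [pre, post, phi_add, phi_single, zfib, Nat.fib_add_two]
  | c => simp [pre, post, phi_add, phi_single, zfib, Nat.fib_add_two]
  | s j => simp [pre, post, phi_add, phi_single, zfib, Nat.fib_add_two]; ring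
  | d j => simp [pre, post, phi_add, phi_single, zfib, Nat.fib_add_two]; ring

theorem zero_mv (m : Mv) : pre m 0 = 0 ∧ post m 0 = 0 := by
  cases m <;> simp [pre, post]

theorem grun_inv {x y : ZState} {w : List Mv} (h : GRun x w y) :
    phi zfib y = phi zfib x ∧ y 0 = x 0 := by
  induction w generalizing x with
  | nil => simp only [GRun] at h; simp [h]
  | cons m w ih =>
    obtain ⟨k, rfl, h⟩ := h
    have := ih h
    rw [this.1, this.2]
    simp [phi_add, val_mv, zero_mv]

theorem phi_le (x : ZState) : phi (fun _ => 1) x ≤ phi zfib x := by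
  unfold phi
  refine Finset.sum_le_sum ?_
  intro i _
  exact Nat.mul_le_mul_left _ (Nat.fib_pos.2 (by omega))

theorem exists_end (n : ℕ) : ∀ x : ZState, phi zfib x ≤ phi (fun _ => 1) x + n →
    ∃ w y, GRun x w y ∧ ∀ i, 2 ≤ i → y i = 0 := by
  induction n with
  | zero =>
    intro x hx
    refine ⟨[], x, rfl, ?_⟩
    intro i hi
    by_contra hne
    obtain ⟨k, rfl⟩ : ∃ k, x = k + Finsupp.single i 1 :=
        ⟨x - Finsupp.single i 1, (tsub_add_cancel_of_le (by rw [Finsupp.single_le_iff]; omega)).symm⟩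
    simp only [phi_add, phi_single] at hx
    have := phi_le k
    have h2 : 1 < zfib i := by
      unfold zfib
      have : Nat.fib 3 ≤ Nat.fib (i+1) := Nat.fib_mono (by omega)
      simp [Nat.fib_add_two] at this
      omega
    omega
  | succ n ih =>
    intro x hx
    by_cases hex : ∃ i, 2 ≤ i ∧ x i ≠ 0
    · obtain ⟨i, hi, hne⟩ := hex
      obtain ⟨k, rfl⟩ : ∃ k, x = k + Finsupp.single i 1 :=
        ⟨x - Finsupp.single i 1, (tsub_add_cancel_of_le (by rw [Finsupp.single_le_iff]; omega)).symm⟩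
      obtain ⟨m, hm, hm2⟩ : ∃ m, post m = Finsupp.single i 1 ∧
          phi (fun _ => 1) (pre m) = 2 := by
        obtain rfl | rfl | ⟨j, rfl⟩ : i = 2 ∨ i = 3 ∨ ∃ j, i = j + 4 := by
          rcases Nat.lt_or_ge i 4 with h | h
          · omega
          · exact Or.inr (Or.inr ⟨i - 4, by omega⟩)
        · exact ⟨.a, rfl, by simp [pre, phi_single]⟩
        · exact ⟨.b, rfl, by simp [pre, phi_add, phi_single]⟩
        · exact ⟨.s j, rfl, by simp [pre, phi_add, phi_single]⟩
      rw [← hm] at hx ⊢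
      obtain ⟨w, y, hw, hy⟩ := ih (k + pre m) (by
        have h3 : phi (fun _ => 1) (post m) = 1 := by rw [hm, phi_single]
        rw [phi_add, phi_add] at hx ⊢
        rw [val_mv, hm2]
        omega)
      exact ⟨m :: w, y, ⟨k, rfl, hw⟩, hy⟩
    · push Not at hex
      exact ⟨[], x, rfl, hex⟩

theorem end_eq {N : ℕ} {x y : ZState} {w : List Mv} (hx : IsZeckendorf N x) (h : GRun x w y)
    (hy : ∀ i, 2 ≤ i → y i = 0) : y = Finsupp.single 1 N := by
  obtain ⟨h1, h2⟩ := grun_inv h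
  have hv : phi zfib x = N := hx.2.2.2
  have e : y = Finsupp.single 1 (y 1) := by
    ext i
    rw [Finsupp.single_apply]
    split_ifs with hi
    · rw [hi]
    · rcases Nat.lt_or_ge i 2 with h' | h'
      · have : i = 0 := by omega
        rw [this, h2, hx.1]
      · exact hy i h'
  rw [e, phi_single, hv] at h1
  simp [zfib] at h1
  rw [e, h1]

theorem PP_pos {N : ℕ} {x : ZState} (hx : IsZeckendorf N x) : 0 < (PP N x).card := by
  obtain ⟨w, y, hw, hy⟩ := exists_end (phi zfib x) x (by omega)
  have := end_eq hx hw hy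
  subst this
  refine Finset.card_pos.2 ⟨w.reverse, ?_⟩
  rw [mem_PP]; exact grun_iff.1 hw

theorem card_plays {N : ℕ} {x : ZState} (hx : IsZeckendorf N x) (Q : ℕ → Prop) [DecidablePred Q] :
    Nat.card {l : List ZState // IsCompletePlay x l ∧ Q (l.length - 1)} =
      ((PP N x).filter fun w => Q w.length).card := by
  classical
  have e : {l : List ZState | IsCompletePlay x l ∧ Q (l.length - 1)} =
      (fun w : List Mv => toPlay x w.reverse) '' ((PP N x).filter fun w => Q w.length) := by
    ext l
    simp only [Set.mem_setOf_eq, Set.mem_image, Finset.coe_filter, mem_PP]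
    constructor
    · rintro ⟨⟨h1, h2, h3⟩, h4⟩
      obtain ⟨w, y, hw, rfl⟩ := toPlay_surj l x h1 h2
      have hy := h3 y (by rw [(toPlay_ok hw).2]; rfl)
      have := end_eq hx hw (terminal_iff.1 hy)
      subst this
      refine ⟨w.reverse, ⟨grun_iff.1 hw, ?_⟩, by simp⟩
      rw [toPlay_length] at h4
      simpa using h4
    · rintro ⟨w, ⟨hw, hq⟩, rfl⟩
      have hg : GRun x w.reverse (Finsupp.single 1 N) := by rw [grun_iff]; simpa using hw
      have ok := toPlay_ok hg
      refine ⟨⟨?_, ok.1, ?_⟩, ?_⟩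
      · obtain ⟨l, hl⟩ := toPlay_head x w.reverse
        rw [hl]; rfl
      · rw [ok.2]
        rintro y hy
        simp at hy; subst hy
        rw [terminal_iff]
        intro i hi
        rw [Finsupp.single_apply, if_neg (by omega)]
      · rw [toPlay_length]; simpa using hq
  have e2 : Nat.card {l : List ZState // IsCompletePlay x l ∧ Q (l.length - 1)} =
      Set.ncard {l : List ZState | IsCompletePlay x l ∧ Q (l.length - 1)} := Nat.card_coe_set_eq _
  rw [e2, e, Set.ncard_image_of_injOn, Set.ncard_coe_finset]
  intro w hw w' hw' he
  simp only [Finset.coe_filter, mem_PP, Set.mem_setOf_eq] at hw hw'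
  have hg : GRun x w.reverse (Finsupp.single 1 N) := by rw [grun_iff]; simpa using hw.1
  have hg' : GRun x w'.reverse (Finsupp.single 1 N) := by rw [grun_iff]; simpa using hw'.1
  exact List.reverse_injective (toPlay_inj hg hg' he)


theorem norm_lt_two {ω : ℂ} (h : ‖ω‖ = 1) (h1 : ω ≠ 1) : ‖1 + ω‖ / 2 < 1 := by
  have hs : ω.re * ω.re + ω.im * ω.im = 1 := by
    have := Complex.normSq_eq_norm_sq ω
    rw [h, Complex.normSq_apply] at this
    linarith
  have hre : ω.re < 1 := by
    by_contra hc
    apply h1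
    have h2 : ω.re = 1 := by nlinarith [mul_self_nonneg ω.im]
    have h3 : ω.im = 0 := by
      have : ω.im * ω.im = 0 := by rw [h2] at hs; linarith
      exact mul_self_eq_zero.1 this
    apply Complex.ext <;> simp [h2, h3]
  have h4 : ‖1 + ω‖ ^ 2 = 2 + 2 * ω.re := by
    rw [← Complex.normSq_eq_norm_sq, Complex.normSq_apply]
    simp
    nlinarith
  nlinarith [norm_nonneg (1 + ω)]

theorem char_small {ω : ℂ} (h : ‖ω‖ = 1) (h1 : ω ≠ 1) (zf : ℕ → ZState)
    (hzf : ∀ N, 0 < N → IsZeckendorf N (zf N)) {ε : ℝ} (hε : 0 < ε) :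
    ∃ N0, ∀ N ≥ N0, ‖∑ w ∈ PP N (zf N), ω ^ w.length‖ ≤ ε * (PP N (zf N)).card := by
  classical
  have hr := norm_lt_two h h1
  set r := ‖1 + ω‖ / 2 with hrdef
  have hr0 : 0 ≤ r := by positivity
  obtain ⟨K, hK⟩ := exists_pow_lt_of_lt_one (half_pos hε) hr
  obtain ⟨n, hn⟩ := exists_nat_gt (4 / ε)
  obtain ⟨N0, hN0⟩ := rare K n
  refine ⟨max N0 1, fun N hN => ?_⟩
  have hz := hzf N (by have := le_max_right N0 1; omega)
  have hb := hN0 N (le_trans (le_max_left _ _) hN) (zf N) (hz.2.1 1) (hz.2.1 2) (PP N (zf N))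
    (mem_PP N (zf N))
  refine (char_bound _ _ _ (mem_PP N (zf N)) ω h).trans ?_
  rw [← hrdef]
  set P := PP N (zf N)
  set B := P.filter fun w => tok (Finsupp.single 1 N) w ≤ K with hB
  have hn0 : (0 : ℝ) < n := lt_trans (by positivity) hn
  have hb' : (B.card : ℝ) * n ≤ 2 * P.card := by exact_mod_cast hb
  have hb2 : (B.card : ℝ) ≤ ε / 2 * P.card := by
    have h4 : 4 < n * ε := by rwa [div_lt_iff₀ hε] at hn
    have hp : (0 : ℝ) ≤ P.card := by positivity
    have : (B.card : ℝ) * n ≤ (ε / 2 * P.card) * n := by nlinarith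
    exact le_of_mul_le_mul_right this hn0
  rw [← Finset.sum_filter_add_sum_filter_not P (fun w => tok (Finsupp.single 1 N) w ≤ K)]
  have s1 : ∑ w ∈ B, r ^ tok (Finsupp.single 1 N) w ≤ B.card := by
    calc _ ≤ ∑ w ∈ B, (1 : ℝ) := Finset.sum_le_sum fun w _ => pow_le_one₀ hr0 hr.le
      _ = _ := by simp
  have s2 : ∑ w ∈ P.filter (fun w => ¬ tok (Finsupp.single 1 N) w ≤ K),
      r ^ tok (Finsupp.single 1 N) w ≤ ε / 2 * P.card := by
    calc _ ≤ ∑ w ∈ P.filter (fun w => ¬ tok (Finsupp.single 1 N) w ≤ K), ε / 2 := by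
            refine Finset.sum_le_sum fun w hw => ?_
            have := (Finset.mem_filter.1 hw).2
            exact (pow_le_pow_of_le_one hr0 hr.le (by omega)).trans hK.le
      _ ≤ ∑ w ∈ P, ε / 2 :=
            Finset.sum_le_sum_of_subset_of_nonneg (Finset.filter_subset _ _)
              (fun _ _ _ => by positivity)
      _ = _ := by simp [mul_comm]
  linarith

theorem count_char (Z : ℕ) (hZ : 1 ≤ Z) (z : ℕ) (hz : z < Z) (P : Finset (List Mv)) {ζ : ℂ}
    (hζ : IsPrimitiveRoot ζ Z) :
    |(Z : ℝ) * ((P.filter fun w => w.length % Z = z).card : ℝ) - P.card| ≤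
      ∑ j ∈ Finset.Ico 1 Z, ‖∑ w ∈ P, (ζ ^ j) ^ w.length‖ := by
  have hn : ‖ζ‖ = 1 := hζ.norm'_eq_one (by omega)
  have key : ∀ m : ℕ, ∑ j ∈ Finset.range Z, (ζ ^ j) ^ (Z - z) * (ζ ^ j) ^ m =
      if m % Z = z then (Z : ℂ) else 0 := by
    intro m
    have e : ∀ j, (ζ ^ j) ^ (Z - z) * (ζ ^ j) ^ m = (ζ ^ (Z - z + m)) ^ j := by
      intro j; rw [← pow_add, ← pow_mul, ← pow_mul, mul_comm]
    simp only [e]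
    have hd : ζ ^ (Z - z + m) = 1 ↔ m % Z = z := by
      rw [hζ.pow_eq_one_iff_dvd]
      have hm := Nat.div_add_mod m Z
      have hml := Nat.mod_lt m (show 0 < Z by omega)
      constructor
      · intro hd
        have : Z ∣ Z - z + m % Z := by
          have e2 : Z - z + m = Z * (m / Z) + (Z - z + m % Z) := by omega
          rw [e2] at hd
          exact (Nat.dvd_add_right (Dvd.intro _ rfl)).1 hd
        obtain ⟨c, hc⟩ := this
        rcases c with _ | _ | c
        · simp at hc; omega
        · simp at hc; omega
        · have : Z * (c + 1 + 1) = Z * c + 2 * Z := by ring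
          have : 0 ≤ Z * c := Nat.zero_le _
          omega
      · intro h
        refine ⟨m / Z + 1, ?_⟩
        rw [mul_add]; omega
    split_ifs with h
    · rw [hd.2 h]; simp
    · have h1 : ζ ^ (Z - z + m) ≠ 1 := fun hh => h (hd.1 hh)
      rw [geom_sum_eq h1, ← pow_mul, mul_comm, pow_mul, hζ.pow_eq_one]
      simp
  have tot : ((Z : ℂ) * ((P.filter fun w => w.length % Z = z).card : ℂ) - P.card) =
      ∑ j ∈ Finset.Ico 1 Z, (ζ ^ j) ^ (Z - z) * ∑ w ∈ P, (ζ ^ j) ^ w.length := by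
    have a : ∑ j ∈ Finset.range Z, (ζ ^ j) ^ (Z - z) * ∑ w ∈ P, (ζ ^ j) ^ w.length =
        (Z : ℂ) * ((P.filter fun w => w.length % Z = z).card : ℂ) := by
      simp only [Finset.mul_sum]
      rw [Finset.sum_comm]
      simp only [key]
      rw [← Finset.sum_filter]
      simp [mul_comm]
    rw [← a, Finset.range_eq_Ico, Finset.sum_eq_sum_Ico_succ_bot (by omega)]
    simp
  have e : |(Z : ℝ) * ((P.filter fun w => w.length % Z = z).card : ℝ) - P.card| =
      ‖((Z : ℂ) * ((P.filter fun w => w.length % Z = z).card : ℂ) - P.card)‖ := by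
    rw [← Real.norm_eq_abs, ← Complex.norm_real]
    push_cast
    rfl
  rw [e, tot]
  refine (norm_sum_le _ _).trans (Finset.sum_le_sum fun j _ => ?_)
  rw [norm_mul]
  simp [hn]

theorem main_lim (Z : ℕ) (hZ : 1 ≤ Z) (z : ℕ) (hz : z < Z) (zf : ℕ → ZState)
    (hzf : ∀ N, 0 < N → IsZeckendorf N (zf N)) {ε : ℝ} (hε : 0 < ε) :
    ∃ N0, ∀ N ≥ N0, 0 < (PP N (zf N)).card ∧
      |(((PP N (zf N)).filter fun w => w.length % Z = z).card : ℝ) / (PP N (zf N)).card - 1 / Z|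
        ≤ ε := by
  have hζ := Complex.isPrimitiveRoot_exp Z (by omega)
  set ζ := Complex.exp (2 * Real.pi * Complex.I / Z)
  have hn : ‖ζ‖ = 1 := hζ.norm'_eq_one (by omega)
  have h : ∀ j, ∃ N0, j ∈ Finset.Ico 1 Z → ∀ N ≥ N0,
      ‖∑ w ∈ PP N (zf N), (ζ ^ j) ^ w.length‖ ≤ ε * (PP N (zf N)).card := by
    intro j
    by_cases hj : j ∈ Finset.Ico 1 Z
    · rw [Finset.mem_Ico] at hj
      obtain ⟨N0, h0⟩ := char_small (ω := ζ ^ j) (by simp [hn])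
        (hζ.pow_ne_one_of_pos_of_lt (by omega) hj.2) zf hzf hε
      exact ⟨N0, fun _ => h0⟩
    · exact ⟨0, fun h => absurd h hj⟩
  choose f hf using h
  refine ⟨max 1 ((Finset.Ico 1 Z).sup f), fun N hN => ?_⟩
  have hN1 : 0 < N := lt_of_lt_of_le Nat.one_pos (le_trans (le_max_left _ _) hN)
  have hpos := PP_pos (hzf N hN1)
  refine ⟨hpos, ?_⟩
  have hb := count_char Z hZ z hz (PP N (zf N)) hζ
  have hs : ∑ j ∈ Finset.Ico 1 Z, ‖∑ w ∈ PP N (zf N), (ζ ^ j) ^ w.length‖ ≤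
      (Z : ℝ) * (ε * (PP N (zf N)).card) := by
    calc _ ≤ ∑ j ∈ Finset.Ico 1 Z, ε * ((PP N (zf N)).card : ℝ) := by
            refine Finset.sum_le_sum fun j hj => hf j hj N ?_
            exact le_trans (Finset.le_sup hj) (le_trans (le_max_right _ _) hN)
      _ = ((Z - 1 : ℕ) : ℝ) * (ε * (PP N (zf N)).card) := by simp
      _ ≤ _ := by
            refine mul_le_mul_of_nonneg_right ?_ (by positivity)
            exact_mod_cast Nat.sub_le _ _
  have hc : (0 : ℝ) < (PP N (zf N)).card := by exact_mod_cast hpos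
  have hZ0 : (0 : ℝ) < Z := by exact_mod_cast hZ
  generalize ((PP N (zf N)).card : ℝ) = c at *
  generalize (((PP N (zf N)).filter fun w => w.length % Z = z).card : ℝ) = a at *
  have e : a / c - 1 / Z = (Z * a - c) / (Z * c) := by field_simp
  rw [e, abs_div, abs_of_pos (mul_pos hZ0 hc), div_le_iff₀ (mul_pos hZ0 hc)]
  linarith

end ZG


open Filter in
/-- For every `Z ≥ 1` and `z ∈ {0, …, Z−1}`, the proportion of complete plays of the
reversed Zeckendorf game on `N` whose length is congruent to `z` mod `Z` converges
to `1/Z` as `N → ∞`. Here `zf` assigns to each positive integer its Zeckendorf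
decomposition. -/
theorem reversedZeckendorf_game_length_equidistributed (Z : ℕ) (hZ : 1 ≤ Z)
    (z : ℕ) (hz : z < Z) (zf : ℕ → ZState) (hzf : ∀ N, 0 < N → IsZeckendorf N (zf N)) :
    Tendsto
      (fun N : ℕ =>
        ((Nat.card {l : List ZState //
            IsCompletePlay (zf N) l ∧ (l.length - 1) % Z = z} : ℝ) /
          (Nat.card {l : List ZState // IsCompletePlay (zf N) l} : ℝ)))
      atTop (nhds (1 / (Z : ℝ))) := by
  rw [Metric.tendsto_atTop]
  intro ε hε
  obtain ⟨N0, h0⟩ := ZG.main_lim Z hZ z hz zf hzf (half_pos hε)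
  refine ⟨max N0 1, fun N hN => ?_⟩
  have hz' := hzf N (lt_of_lt_of_le Nat.one_pos (le_trans (le_max_right _ _) hN))
  have h1 := ZG.card_plays hz' (fun m => m % Z = z)
  have h2 := ZG.card_plays hz' (fun _ => True)
  simp only [and_true, Finset.filter_true] at h2
  rw [h1, h2, Real.dist_eq]
  have := (h0 N (le_trans (le_max_left _ _) hN)).2
  linarith
end

section
/- For every even integer n ≥ 4, in the randomly played reversed Zeckendorf game on n the probability that the length of the complete play is odd equals 1/2. -/
/-- The probability of a given play in the randomly played game: the product, over
the non-terminal states along the play, of the reciprocals of the numbers of legal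
moves available there. -/
noncomputable def playProb (l : List ZState) : ℝ :=
  (l.dropLast.map fun s => (1 : ℝ) / (Nat.card {t : ZState // ZMove s t})).prod

open Finsupp in
lemma zmove_iff (h t : ZState) : ZMove h t ↔
    (∃ j g, h = g + single (j+3) 1 ∧ t = g + single (j+2) 1 + single (j+1) 1) ∨
    (∃ g, h = g + single 2 1 ∧ t = g + single 1 2) ∨
    (∃ j g, h = g + single (j+4) 1 + single (j+1) 1 ∧ t = g + single (j+3) 2) ∨
    (∃ g, h = g + single 3 1 + single 1 1 ∧ t = g + single 2 2) := by
  constructor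
  · intro H
    cases H with
    | split i hi hpos =>
      obtain ⟨j, rfl⟩ := Nat.exists_eq_add_of_le' hi
      refine Or.inl ⟨j, h - single (j+3) 1, ?_, rfl⟩
      ext k
      by_cases hk : k = j + 3
      · subst hk
        have hpos' : 0 < h (j+3) := hpos
        simp; omega
      · simp [single_apply, Ne.symm hk]
    | splitTwo hpos =>
      refine Or.inr (Or.inl ⟨h - single 2 1, ?_, rfl⟩)
      ext k
      by_cases hk : k = 2
      · subst hk; simp at hpos ⊢; omega
      · simp [single_apply, Ne.symm hk]
    | combine i hi h1 h2 =>
      obtain ⟨j, rfl⟩ := Nat.exists_eq_add_of_le' (show 3 ≤ i from hi)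
      refine Or.inr (Or.inr (Or.inl ⟨j, h - single (j+4) 1 - single (j+1) 1, ?_, rfl⟩))
      have h2' : 0 < h (j+1) := h2
      have h1' : 0 < h (j+4) := h1
      ext k
      simp only [Finsupp.add_apply, Finsupp.tsub_apply, single_apply]
      by_cases hk : k = j + 4
      · subst hk; simp; omega
      · by_cases hk' : k = j + 1
        · subst hk'; simp; omega
        · simp [Ne.symm hk, Ne.symm hk']
    | combineTwo h1 h2 =>
      refine Or.inr (Or.inr (Or.inr ⟨h - single 3 1 - single 1 1, ?_, rfl⟩))
      ext k
      simp only [Finsupp.add_apply, Finsupp.tsub_apply, single_apply]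
      by_cases hk : k = 3
      · subst hk; simp; omega
      · by_cases hk' : k = 1
        · subst hk'; simp; omega
        · simp [Ne.symm hk, Ne.symm hk']
  · rintro (⟨j, g, rfl, rfl⟩ | ⟨g, rfl, rfl⟩ | ⟨j, g, rfl, rfl⟩ | ⟨g, rfl, rfl⟩)
    · have := ZMove.split (g + single (j+3) 1) (j+2) (by omega) (by simp)
      simpa using this
    · have := ZMove.splitTwo (g + single 2 1) (by simp)
      simpa using this
    · have := ZMove.combine (g + single (j+4) 1 + single (j+1) 1) (j+3) (by omega)
        (by simp) (by simp)
      rw [add_right_comm g] at this ⊢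
      simpa using this
    · have := ZMove.combineTwo (g + single 3 1 + single 1 1)
        (by simp) (by simp)
      rw [add_right_comm g] at this ⊢
      simpa using this

noncomputable def zM : ZState →+ ℕ := Finsupp.weight (fun i => 3 ^ i)
noncomputable def zV : ZState →+ ℕ := Finsupp.weight (fun i => if i = 0 then 0 else Nat.fib (i + 1))
noncomputable def zC : ZState →+ ℕ := Finsupp.weight (fun i => if 3 ≤ i then 1 else 0)

@[simp] lemma zM_single (i a : ℕ) : zM (Finsupp.single i a) = a * 3 ^ i := by
  simp [zM, Finsupp.weight_single]
@[simp] lemma zV_single (i a : ℕ) :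
    zV (Finsupp.single i a) = a * (if i = 0 then 0 else Nat.fib (i + 1)) := by
  simp [zV, Finsupp.weight_single]
@[simp] lemma zC_single (i a : ℕ) :
    zC (Finsupp.single i a) = a * (if 3 ≤ i then 1 else 0) := by
  simp [zC, Finsupp.weight_single]

lemma zM_lt {h t : ZState} (H : ZMove h t) : zM t < zM h := by
  rw [zmove_iff] at H
  rcases H with (⟨j, g, rfl, rfl⟩ | ⟨g, rfl, rfl⟩ | ⟨j, g, rfl, rfl⟩ | ⟨g, rfl, rfl⟩) <;>
    simp [pow_succ]
  · have : 0 < 3 ^ j := by positivity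
    omega
  · have : 0 < 3 ^ j := by positivity
    omega

lemma zV_eq {h t : ZState} (H : ZMove h t) : zV t = zV h := by
  rw [zmove_iff] at H
  rcases H with (⟨j, g, rfl, rfl⟩ | ⟨g, rfl, rfl⟩ | ⟨j, g, rfl, rfl⟩ | ⟨g, rfl, rfl⟩)
  · have := Nat.fib_add_two (n := j + 2)
    simp [add_assoc] at this ⊢; omega
  · simp [Nat.fib_add_two]
  · have := Nat.fib_add_two (n := j + 3)
    have := Nat.fib_add_two (n := j + 2)
    simp [add_assoc] at *; omega
  · simp [Nat.fib_add_two, add_assoc]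

lemma zC_low {g : ZState} (H : zC g = 0) (i : ℕ) (hi : 3 ≤ i) : g i = 0 := by
  by_contra hne
  have : g = (g - Finsupp.single i 1) + Finsupp.single i 1 := by
    ext k
    by_cases hk : k = i
    · subst hk; simp; omega
    · simp [Finsupp.single_apply, Ne.symm hk]
  rw [this] at H
  simp [hi] at H

lemma zV_low {g : ZState} (H : zC g = 0) : zV g = g 1 + 2 * g 2 := by
  have : g = Finsupp.single 0 (g 0) + Finsupp.single 1 (g 1) + Finsupp.single 2 (g 2) := by
    ext k
    rcases k with _ | _ | _ | k
    · simp
    · simp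
    · simp
    · simp [zC_low H (k+3) (by omega), Finsupp.single_apply]
  conv_lhs => rw [this]
  simp [Nat.fib_add_two]
  omega

lemma zsucc_finite (h : ZState) : {t | ZMove h t}.Finite := by
  classical
  have f1 := h.support.finite_toSet
  refine Set.Finite.subset (s := (fun i => h - Finsupp.single (i) 1 + Finsupp.single (i-1) 1
     + Finsupp.single (i - 1 - 1) 1) '' h.support ∪ {h - Finsupp.single 2 1 + Finsupp.single 1 2}
     ∪ (fun i => h - Finsupp.single i 1 - Finsupp.single (i - 1 - 2) 1 + Finsupp.single (i-1) 2) '' h.support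
     ∪ {h - Finsupp.single 3 1 - Finsupp.single 1 1 + Finsupp.single 2 2}) ?_ ?_
  · exact (((f1.image _).union (Set.finite_singleton _)).union (f1.image _)).union
      (Set.finite_singleton _)
  · intro t ht
    cases ht with
    | split i hi hpos =>
      exact Or.inl (Or.inl (Or.inl ⟨i+1, by simp; omega, by simp⟩))
    | splitTwo hpos => exact Or.inl (Or.inl (Or.inr rfl))
    | combine i hi h1 h2 =>
      exact Or.inl (Or.inr ⟨i+1, by simp; omega, by simp⟩)
    | combineTwo h1 h2 => exact Or.inr rfl

def ZVal (s : ZState) (c v : ℝ) : Prop :=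
  ∃ F : Finset (List ZState), (∀ l, l ∈ F ↔ IsCompletePlay s l) ∧
    ∑ l ∈ F, playProb l * c ^ (l.length - 1) = v

lemma play_cons (s : ZState) (l : List ZState) (hs : ∃ t, ZMove s t) :
    IsCompletePlay s l ↔ ∃ t m, ZMove s t ∧ IsCompletePlay t m ∧ l = s :: m := by
  unfold IsCompletePlay
  rcases l with _ | ⟨a, _ | ⟨b, m⟩⟩
  · simp
  · simp
    rintro rfl
    exact fun _ => hs
  · simp only [List.head?_cons, Option.some.injEq]
    constructor
    · rintro ⟨rfl, h1, h2⟩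
      have h1' := List.isChain_cons_cons.1 h1
      exact ⟨b, b :: m, h1'.1, ⟨rfl, h1'.2, by simpa using h2⟩, rfl⟩
    · rintro ⟨t, m', h1, ⟨h2, h3, h4⟩, h5⟩
      obtain ⟨rfl, rfl⟩ := List.cons.inj h5
      simp at h2
      subst h2
      exact ⟨rfl, List.isChain_cons_cons.2 ⟨h1, h3⟩, by simpa using h4⟩

lemma zval_terminal (s : ZState) (c : ℝ) (hs : ∀ t, ¬ ZMove s t) : ZVal s c 1 := by
  refine ⟨{[s]}, ?_, by simp [playProb]⟩
  intro l
  rw [Finset.mem_singleton]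
  constructor
  · rintro rfl
    exact ⟨rfl, List.isChain_singleton _, by simpa using hs⟩
  · rintro ⟨h1, h2, h3⟩
    rcases l with _ | ⟨a, _ | ⟨b, m⟩⟩
    · simp at h1
    · simp at h1; rw [h1]
    · simp at h1
      subst h1
      exact absurd (List.isChain_cons_cons.1 h2).1 (hs _)

lemma zval_step (s : ZState) (c : ℝ) (v : ZState → ℝ) (T : Finset ZState)
    (hT : ∀ t, t ∈ T ↔ ZMove s t) (hne : T.Nonempty) (hv : ∀ t ∈ T, ZVal t c (v t)) :
    ZVal s c (c / T.card * ∑ t ∈ T, v t) := by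
  classical
  have hv' : ∀ t, ∃ F : Finset (List ZState), t ∈ T → (∀ l, l ∈ F ↔ IsCompletePlay t l) ∧
    ∑ l ∈ F, playProb l * c ^ (l.length - 1) = v t := by
    intro t
    by_cases ht : t ∈ T
    · obtain ⟨F, hF⟩ := hv t ht
      exact ⟨F, fun _ => hF⟩
    · exact ⟨∅, fun h => absurd h ht⟩
  choose F hF using hv'
  have hs : ∃ t, ZMove s t := by
    obtain ⟨t, ht⟩ := hne
    exact ⟨t, (hT t).1 ht⟩
  have hcard : Nat.card {t : ZState // ZMove s t} = T.card := by
    rw [Nat.subtype_card T hT]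
  refine ⟨T.biUnion (fun t => (F t).image (List.cons s)), ?_, ?_⟩
  · intro l
    rw [play_cons s l hs]
    simp only [Finset.mem_biUnion, Finset.mem_image]
    constructor
    · rintro ⟨t, ht, m, hm, rfl⟩
      exact ⟨t, m, (hT t).1 ht, ((hF t ht).1 m).1 hm, rfl⟩
    · rintro ⟨t, m, ht, hm, rfl⟩
      have ht' := (hT t).2 ht
      exact ⟨t, ht', m, ((hF t ht').1 m).2 hm, rfl⟩
  · rw [Finset.sum_biUnion]
    · rw [Finset.mul_sum]
      refine Finset.sum_congr rfl fun t ht => ?_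
      rw [Finset.sum_image (fun a _ b _ hab => (List.cons.inj hab).2), ← (hF t ht).2,
        Finset.mul_sum]
      refine Finset.sum_congr rfl fun l hl => ?_
      have hl' := ((hF t ht).1 l).1 hl
      rcases l with _ | ⟨a, m⟩
      · simp [IsCompletePlay] at hl'
      · simp only [playProb, List.dropLast_cons_cons, List.map_cons, List.prod_cons, hcard,
          List.length_cons, Nat.add_sub_cancel]
        ring
    · intro t ht t' ht' hne'
      simp only [Function.onFun]
      rw [Finset.disjoint_left]
      intro l hl hl'
      simp only [Finset.mem_image] at hl hl'
      obtain ⟨m, hm, rfl⟩ := hl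
      obtain ⟨m', hm', he⟩ := hl'
      obtain ⟨_, rfl⟩ := List.cons.inj he
      have e1 := (((hF t ht).1 m').1 hm).1
      have e2 := (((hF t' ht').1 m').1 hm').1
      rw [e1] at e2
      exact hne' (Option.some.inj e2)

lemma zval_one (s : ZState) : ZVal s 1 1 := by
  induction hk : zM s using Nat.strong_induction_on generalizing s with
  | _ k ih =>
    by_cases hs : ∃ t, ZMove s t
    · have hT : ∀ t, t ∈ (zsucc_finite s).toFinset ↔ ZMove s t := by simp
      have hne : (zsucc_finite s).toFinset.Nonempty := by
        obtain ⟨t, ht⟩ := hs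
        exact ⟨t, (hT t).2 ht⟩
      have := zval_step s 1 (fun _ => 1) _ hT hne
        (fun t ht => ih _ (hk ▸ zM_lt ((hT t).1 ht)) t rfl)
      have hc : ((zsucc_finite s).toFinset.card : ℝ) ≠ 0 := by
        exact_mod_cast hne.card_pos.ne'
      simpa [hc] using this
    · push Not at hs
      exact zval_terminal s 1 hs

open Classical in
noncomputable def zv (h : ZState) : ℝ := if zC h = 0 then (-1) ^ (h 2) else 0

lemma zC_pos_of {h : ZState} {i : ℕ} (hi : 3 ≤ i) (hp : h i ≠ 0) : zC h ≠ 0 :=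
  fun H => hp (zC_low H i hi)

lemma exists_of_zC {h : ZState} (H : zC h ≠ 0) : ∃ i, 3 ≤ i ∧ h i ≠ 0 := by
  by_contra! hc
  apply H
  have : h = Finsupp.single 0 (h 0) + Finsupp.single 1 (h 1) + Finsupp.single 2 (h 2) := by
    ext k
    rcases k with _ | _ | _ | k
    · simp
    · simp
    · simp
    · simp [hc (k+3) (by omega), Finsupp.single_apply]
  rw [this]
  simp

lemma zsum (s : ZState) (hs : Even (zV s)) (T : Finset ZState)
    (hT : ∀ t, t ∈ T ↔ ZMove s t) (hC : zC s ≠ 0) : ∑ t ∈ T, zv t = 0 := by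
  classical
  by_cases hall : ∀ t ∈ T, zC t ≠ 0
  · exact Finset.sum_eq_zero fun t ht => by simp [zv, hall t ht]
  push Not at hall
  obtain ⟨t, ht, ht0⟩ := hall
  obtain ⟨g, rfl, hg⟩ : ∃ g, s = g + Finsupp.single 3 1 ∧ zC g = 0 := by
    have H := (hT t).1 ht
    rw [zmove_iff] at H
    rcases H with (⟨j, g, rfl, rfl⟩ | ⟨g, rfl, rfl⟩ | ⟨j, g, rfl, rfl⟩ | ⟨g, rfl, rfl⟩)
    · rcases j with _ | j
      · simp at ht0; exact ⟨g, rfl, ht0⟩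
      · simp at ht0
    · simp at ht0 hC; omega
    · simp at ht0
    · simp at ht0
      exact ⟨g + Finsupp.single 1 1, add_right_comm _ _ _, by simp [ht0]⟩
  have h1 : g 1 ≠ 0 := by
    intro h1
    rw [map_add, zV_low hg, h1] at hs
    simp [Nat.fib_add_two, Nat.even_add] at hs
    exact absurd hs (by decide)
  obtain ⟨f, rfl⟩ : ∃ f, g = f + Finsupp.single 1 1 := by
    refine ⟨g - Finsupp.single 1 1, ?_⟩
    ext k
    by_cases hk : k = 1
    · subst hk; simp; omega
    · simp [Finsupp.single_apply, Ne.symm hk]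
  have hf : zC f = 0 := by simpa using hg
  set A : ZState := f + Finsupp.single 1 1 + Finsupp.single 2 1 + Finsupp.single 1 1 with hA
  set B : ZState := f + Finsupp.single 2 2 with hB
  have hAT : A ∈ T := by
    rw [hT, zmove_iff]
    exact Or.inl ⟨0, _, rfl, rfl⟩
  have hBT : B ∈ T := by
    rw [hT, zmove_iff]
    exact Or.inr (Or.inr (Or.inr ⟨f, add_right_comm _ _ _, rfl⟩))
  have hAB : A ≠ B := by
    intro h
    have := DFunLike.congr_fun h 2
    simp [hA, hB] at this
  have hsub : ({A, B} : Finset ZState) ⊆ T := by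
    intro x hx
    simp at hx
    rcases hx with rfl | rfl <;> assumption
  rw [← Finset.sum_subset hsub, Finset.sum_pair hAB]
  · have a0 : zC A = 0 := by simp [hA, hf]
    have b0 : zC B = 0 := by simp [hB, hf]
    have a2 : A 2 = f 2 + 1 := by simp [hA]
    have b2 : B 2 = f 2 + 2 := by simp [hB]
    simp only [zv, a0, b0, a2, b2, if_true]
    ring
  · intro x hx hx'
    have hxc : zC x ≠ 0 := by
      intro hx0
      apply hx'
      have H := (hT x).1 hx
      rw [zmove_iff] at H
      rcases H with (⟨j, g, h, rfl⟩ | ⟨g, h, rfl⟩ | ⟨j, g, h, rfl⟩ | ⟨g, h, rfl⟩)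
      · rcases j with _ | j
        · have := add_right_cancel h
          subst this
          simp [hA]
        · simp at hx0
      · have := congrArg zC h
        simp at this hx0
        omega
      · simp at hx0
      · rw [add_right_comm] at h
        have := add_right_cancel (add_right_cancel h)
        subst this
        simp [hB]
    simp [zv, hxc]

lemma zval_neg (s : ZState) (hs : Even (zV s)) : ZVal s (-1) (zv s) := by
  induction hk : zM s using Nat.strong_induction_on generalizing s with
  | _ k ih =>
    have hT : ∀ t, t ∈ (zsucc_finite s).toFinset ↔ ZMove s t := by simp
    have key : ∀ T : Finset ZState, (∀ t, t ∈ T ↔ ZMove s t) → T.Nonempty →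
        ZVal s (-1) (-1 / T.card * ∑ t ∈ T, zv t) := fun T hT hne =>
      zval_step s (-1) zv T hT hne
        (fun t ht => ih _ (hk ▸ zM_lt ((hT t).1 ht)) t (by rwa [zV_eq ((hT t).1 ht)]) rfl)
    by_cases hC : zC s = 0
    · have hlow := zC_low hC
      have hm : ∀ t, ZMove s t → ∃ g, s = g + Finsupp.single 2 1 ∧ t = g + Finsupp.single 1 2 := by
        intro t H
        rw [zmove_iff] at H
        rcases H with (⟨j, g, rfl, rfl⟩ | ⟨g, rfl, rfl⟩ | ⟨j, g, rfl, rfl⟩ | ⟨g, rfl, rfl⟩)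
        · simp at hC
        · exact ⟨g, rfl, rfl⟩
        · simp at hC
        · simp at hC
      by_cases h2 : s 2 = 0
      · have : zv s = 1 := by simp [zv, hC, h2]
        rw [this]
        apply zval_terminal
        intro t ht
        obtain ⟨g, rfl, _⟩ := hm t ht
        simp at h2
      · have hmv := ZMove.splitTwo s (Nat.pos_of_ne_zero h2)
        obtain ⟨g, rfl, -⟩ := hm _ hmv
        have := key {g + Finsupp.single 1 2} (fun t => by
          rw [Finset.mem_singleton]
          constructor
          · rintro rfl
            rw [zmove_iff]
            exact Or.inr (Or.inl ⟨g, rfl, rfl⟩)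
          · intro h
            obtain ⟨g', h1, rfl⟩ := hm t h
            rw [add_right_cancel h1]) (Finset.singleton_nonempty _)
        have hg : zC g = 0 := by simpa using hC
        convert this using 1
        simp [zv, hg, pow_succ]
    · have hne : (zsucc_finite s).toFinset.Nonempty := by
        obtain ⟨i, hi, hp⟩ := exists_of_zC hC
        obtain ⟨j, rfl⟩ := Nat.exists_eq_add_of_le' hi
        exact ⟨_, (hT _).2 (ZMove.split s (j+2) (by omega) (Nat.pos_of_ne_zero hp))⟩
      have := key _ hT hne
      rw [zsum s hs _ hT hC] at this
      simpa [zv, hC] using this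

theorem reversedZeckendorf_random_game_odd_length (n : ℕ) (hn : Even n) (hn4 : 4 ≤ n)
    (z : ZState) (hz : IsZeckendorf n z) :
    ∑' l : {l : List ZState // IsCompletePlay z l ∧ (l.length - 1) % 2 = 1},
      playProb l.val = 1 / 2 := by
  classical
  obtain ⟨h0, hle, hadj, hsum⟩ := hz
  have hV : zV z = n := by
    rw [← hsum, zV, Finsupp.weight_apply]
    refine Finsupp.sum_congr fun i hi => ?_
    have : i ≠ 0 := by
      rintro rfl
      simp [h0] at hi
    simp [this, zfib]
  have hC : zC z ≠ 0 := by
    intro hC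
    have := zV_low hC
    have := hle 1
    have := hle 2
    have := hadj 1
    simp only [Nat.reduceAdd] at this
    omega
  obtain ⟨F, hF, h1⟩ := zval_one z
  obtain ⟨F', hF', h2⟩ := zval_neg z (hV ▸ hn)
  have : F' = F := by ext l; rw [hF, hF']
  subst this
  have e : ∀ l, l ∈ F'.filter (fun l => (l.length - 1) % 2 = 1) ↔
      IsCompletePlay z l ∧ (l.length - 1) % 2 = 1 := by simp [hF]
  have e2 : ∑' l : {l : List ZState // IsCompletePlay z l ∧ (l.length - 1) % 2 = 1},
      playProb l.val = ∑ l ∈ F'.filter (fun l => (l.length - 1) % 2 = 1), playProb l := by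
    rw [← Finset.tsum_subtype]
    exact (Equiv.subtypeEquivRight e).symm.tsum_eq
      (fun l : {l // l ∈ F'.filter (fun l => (l.length - 1) % 2 = 1)} => playProb l.val)
  rw [e2, Finset.sum_filter]
  have e3 : ∀ l ∈ F', (if (l.length - 1) % 2 = 1 then playProb l else 0) =
      (playProb l * 1 ^ (l.length - 1) - playProb l * (-1) ^ (l.length - 1)) / 2 := by
    intro l _
    split_ifs with h
    · rw [Odd.neg_one_pow (Nat.odd_iff.2 h)]; simp
    · rw [Even.neg_one_pow (Nat.even_iff.2 (by omega))]; simp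
  rw [Finset.sum_congr rfl e3, ← Finset.sum_div, Finset.sum_sub_distrib, h1, h2]
  simp [zv, hC]
end
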